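/- arXiv:1811.10926 — 3 statements merged into one kernel-verified Lean document; each statement's English description precedes it below -/
import Mathlib

section
/- The G₂ cluster ideal I_{G₂} is a prime ideal of R₁₈; equivalently, the G₂ cluster variety X_{G₂} ⊆ ℂ¹⁸ is irreducible and its coordinate ring R₁₈/I_{G₂} is an integral domain. -/
/-!
The G₂ cluster variety.

`R18` is the polynomial ring over ℂ in the 18 variables, indexed as follows:
`0 ↦ θ₁, 1 ↦ θ₁₂, 2 ↦ θ₂, 3 ↦ θ₂₃, 4 ↦ θ₃, 5 ↦ θ₃₄, 6 ↦ θ₄, 7 ↦ θ₄₁,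
 8 ↦ A₁, 9 ↦ A₁₂, 10 ↦ A₂, 11 ↦ A₂₃, 12 ↦ A₃, 13 ↦ A₃₄, 14 ↦ A₄, 15 ↦ A₄₁,
 16 ↦ λ₁₃, 17 ↦ λ₂₄`.
Indices `i : Fin 4` stand for the indices 1,2,3,4 taken modulo 4, with `Fin 4` addition.
-/

open MvPolynomial

noncomputable section

abbrev R18 : Type := MvPolynomial (Fin 18) ℂ

/-- The cluster variables θ₁, θ₂, θ₃, θ₄. -/
def th : Fin 4 → R18 := ![X 0, X 2, X 4, X 6]

/-- The cluster variables θ₁₂, θ₂₃, θ₃₄, θ₄₁ : `thp i = θ_{i,i+1}`. -/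
def thp : Fin 4 → R18 := ![X 1, X 3, X 5, X 7]

/-- The coefficients A₁, A₂, A₃, A₄. -/
def aS : Fin 4 → R18 := ![X 8, X 10, X 12, X 14]

/-- The coefficients A₁₂, A₂₃, A₃₄, A₄₁ : `aP i = A_{i,i+1}`. -/
def aP : Fin 4 → R18 := ![X 9, X 11, X 13, X 15]

/-- The parameters: `lam i = λ_{i,i+2}`, so `λ₁₃ = lam 0 = lam 2` and
`λ₂₄ = lam 1 = lam 3` (unordered pairs of opposite indices). -/
def lam : Fin 4 → R18 := ![X 16, X 17, X 16, X 17]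

/-- `θ_{xy}` for *adjacent* `x y : Fin 4` (unordered pair: `θ_{xy} = θ_{yx}`). -/
def thpp (x y : Fin 4) : R18 := if y = x + 1 then thp x else thp y

/-- `A_{xy}` for *adjacent* `x y : Fin 4` (unordered pair: `A_{xy} = A_{yx}`). -/
def aPP (x y : Fin 4) : R18 := if y = x + 1 then aP x else aP y

/-- The dihedral permutation `(i,j,k,l)` of `(1,2,3,4)` starting at `s` with direction `d`:
position `t` is sent to `s + t` (if `d`) or `s - t` (otherwise). The eight choices of
`(s, d)` give the eight dihedral permutations (cyclic rotations and their reversals). -/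
def dih (s : Fin 4) (d : Bool) (t : Fin 4) : Fin 4 := if d then s + t else s - t

/-- Family 1: `θᵢθⱼ − A_{ij}θ_{ij} − A_{jk}A_kA_{kl}²A_lA_{li}` (4 distinct equations). -/
def f1 (s : Fin 4) (d : Bool) : R18 :=
  let i := dih s d 0; let j := dih s d 1; let k := dih s d 2; let l := dih s d 3
  th i * th j - aPP i j * thpp i j - aPP j k * aS k * aPP k l ^ 2 * aS l * aPP l i

/-- Family 2: `θ_{ij}θ_{jk} − A_jθⱼ³ − λ_{jl}A_{kl}A_{li}θⱼ² − λ_{ik}A_{kl}²A_lA_{li}²θⱼ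
− A_kA_{kl}³A_l²A_{li}³A_i` (4 distinct equations). -/
def f2 (s : Fin 4) (d : Bool) : R18 :=
  let i := dih s d 0; let j := dih s d 1; let k := dih s d 2; let l := dih s d 3
  thpp i j * thpp j k - aS j * th j ^ 3 - lam j * aPP k l * aPP l i * th j ^ 2
    - lam i * aPP k l ^ 2 * aS l * aPP l i ^ 2 * th j
    - aS k * aPP k l ^ 3 * aS l ^ 2 * aPP l i ^ 3 * aS i

/-- Family 3: `θᵢθ_{jk} − A_{ij}A_jθⱼ² − λ_{jl}A_{kl}A_{li}A_{ij}θⱼ − λ_{ik}A_{kl}²A_lA_{li}²A_{ij}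
− A_kA_{kl}²A_lA_{li}θ_k` (8 distinct equations). -/
def f3 (s : Fin 4) (d : Bool) : R18 :=
  let i := dih s d 0; let j := dih s d 1; let k := dih s d 2; let l := dih s d 3
  th i * thpp j k - aPP i j * aS j * th j ^ 2 - lam j * aPP k l * aPP l i * aPP i j * th j
    - lam i * aPP k l ^ 2 * aS l * aPP l i ^ 2 * aPP i j
    - aS k * aPP k l ^ 2 * aS l * aPP l i * th k

/-- Family 4: `θᵢθ_k − A_{ij}A_jA_{jk}θⱼ − λ_{jl}A_{ij}A_{jk}A_{kl}A_{li} − A_{kl}A_lA_{li}θ_l`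
(2 distinct equations). -/
def f4 (s : Fin 4) (d : Bool) : R18 :=
  let i := dih s d 0; let j := dih s d 1; let k := dih s d 2; let l := dih s d 3
  th i * th k - aPP i j * aS j * aPP j k * th j
    - lam j * aPP i j * aPP j k * aPP k l * aPP l i - aPP k l * aS l * aPP l i * th l

/-- Family 5: `θ_{ij}θ_{kl} − A_jA_{jk}²A_kθⱼθ_k − A_{li}A_{jk}(λ_{ik}θᵢθ_k + λ_{jl}θⱼθ_l)
− A_lA_{li}²A_iθ_lθᵢ − A_{ij}A_{jk}²A_{kl}A_{li}²(A_iA_jA_kA_l − λ_{ik}λ_{jl})`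
(2 distinct equations). -/
def f5 (s : Fin 4) (d : Bool) : R18 :=
  let i := dih s d 0; let j := dih s d 1; let k := dih s d 2; let l := dih s d 3
  thpp i j * thpp k l - aS j * aPP j k ^ 2 * aS k * th j * th k
    - aPP l i * aPP j k * (lam i * th i * th k + lam j * th j * th l)
    - aS l * aPP l i ^ 2 * aS i * th l * th i
    - aPP i j * aPP j k ^ 2 * aPP k l * aPP l i ^ 2
        * (aS i * aS j * aS k * aS l - lam i * lam j)

/-- All the generators of the G₂ cluster ideal, indexed by the family (`Fin 5`) and the
dihedral permutation (`Fin 4 × Bool`).  As permutations in the same dihedral orbit of an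
equation give the same polynomial, the set of values of this family consists of the twenty
defining polynomials (4 + 4 + 8 + 2 + 2). -/
def genG2 : Fin 5 → Fin 4 → Bool → R18 := ![f1, f2, f3, f4, f5]

/-- The G₂ cluster ideal, generated by the twenty relations. -/
def IG2 : Ideal R18 :=
  Ideal.span (Set.range (fun x : Fin 5 × Fin 4 × Bool => genG2 x.1 x.2.1 x.2.2))

/-- The G₂ cluster variety `X_{G₂} ⊆ ℂ¹⁸`: the common zero locus of the twenty generators. -/
def XG2 : Set (Fin 18 → ℂ) :=
  {p | ∀ (m : Fin 5) (s : Fin 4) (d : Bool), eval p (genG2 m s d) = 0}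

/-- The eight cluster variables θ₁, θ₁₂, θ₂, θ₂₃, θ₃, θ₃₄, θ₄, θ₄₁. -/
def clusterVar : Fin 8 → R18 := ![X 0, X 1, X 2, X 3, X 4, X 5, X 6, X 7]

end

section Relations

variable {F : Type*} [Field F] [Algebra ℂ F] {p : Fin 18 → F}

theorem aPP_dih_ne_zero (hp : ∀ i, aeval p (aP i) ≠ 0) (s : Fin 4) (d : Bool) (t : Fin 4) :
    aeval p (aPP (dih s d t) (dih s d (t + 1))) ≠ 0 := by
  unfold aPP
  split_ifs
  · exact hp _
  · exact hp _

theorem dih_dih_one (s : Fin 4) (d : Bool) (t : Fin 4) :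
    dih (dih s d 1) d t = dih s d (t + 1) := by
  revert s d t; decide

theorem dih_dih_two (s : Fin 4) (d : Bool) (t : Fin 4) :
    dih (dih s d 2) d t = dih s d (t + 2) := by
  revert s d t; decide

theorem lam_dih_two (s : Fin 4) (d : Bool) : lam (dih s d 2) = lam (dih s d 0) := by
  fin_cases s <;> cases d <;> rfl

/-- Where the `A_{ij}` do not vanish, the relations of family 3 follow from those of
families 1 and 4. -/
theorem aeval_f3_eq_zero (hp : ∀ i, aeval p (aP i) ≠ 0)
    (h1 : ∀ s d, aeval p (f1 s d) = 0) (h4 : ∀ s d, aeval p (f4 s d) = 0)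
    (s : Fin 4) (d : Bool) : aeval p (f3 s d) = 0 := by
  have hA := aPP_dih_ne_zero hp s d 1
  have e1 := h1 (dih s d 1) d
  have e4 := h4 s d
  have e4' := h4 (dih s d 1) d
  simp only [f1, f3, f4, dih_dih_one, lam_dih_two, map_sub, map_mul, map_pow, Fin.reduceAdd]
    at e1 e4 e4' hA ⊢
  generalize aeval p (th (dih s d 0)) = θi at *
  generalize aeval p (th (dih s d 1)) = θj at *
  generalize aeval p (th (dih s d 2)) = θk at *
  generalize aeval p (th (dih s d 3)) = θl at *
  refine (mul_eq_zero_iff_left hA).mp ?_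
  linear_combination (-θi) * e1 + θj * e4 + aeval p (aPP (dih s d 2) (dih s d 3)) *
    aeval p (aS (dih s d 3)) * aeval p (aPP (dih s d 3) (dih s d 0)) * e4'

/-- Where the `A_{ij}` do not vanish, the relations of family 2 follow from those of
families 1 and 4. -/
theorem aeval_f2_eq_zero (hp : ∀ i, aeval p (aP i) ≠ 0)
    (h1 : ∀ s d, aeval p (f1 s d) = 0) (h4 : ∀ s d, aeval p (f4 s d) = 0)
    (s : Fin 4) (d : Bool) : aeval p (f2 s d) = 0 := by
  have hA := aPP_dih_ne_zero hp s d 0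
  have e1 := h1 s d
  have e1' := h1 (dih s d 1) d
  have e3 := aeval_f3_eq_zero hp h1 h4 s d
  simp only [f1, f2, f3, dih_dih_one, map_sub, map_mul, map_pow, Fin.reduceAdd]
    at e1 e1' e3 hA ⊢
  refine (mul_eq_zero_iff_left hA).mp ?_
  linear_combination (-aeval p (thpp (dih s d 1) (dih s d 2))) * e1
    + aeval p (th (dih s d 1)) * e3 + aeval p (aS (dih s d 2)) *
    aeval p (aPP (dih s d 2) (dih s d 3)) ^ 2 *
    aeval p (aS (dih s d 3)) * aeval p (aPP (dih s d 3) (dih s d 0)) * e1'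

/-- Where the `A_{ij}` do not vanish, the relations of family 5 follow from those of
families 1 and 4. -/
theorem aeval_f5_eq_zero (hp : ∀ i, aeval p (aP i) ≠ 0)
    (h1 : ∀ s d, aeval p (f1 s d) = 0) (h4 : ∀ s d, aeval p (f4 s d) = 0)
    (s : Fin 4) (d : Bool) : aeval p (f5 s d) = 0 := by
  have hA := aPP_dih_ne_zero hp s d 0
  have e1 := h1 s d
  have e1' := h1 (dih s d 2) d
  have e3 := aeval_f3_eq_zero hp h1 h4 (dih s d 1) d
  have e4 := h4 s d
  have e4' := h4 (dih s d 1) d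
  simp only [f1, f3, f4, f5, dih_dih_one, dih_dih_two, lam_dih_two, map_sub, map_add, map_mul,
    map_pow, Fin.reduceAdd] at e1 e1' e3 e4 e4' hA ⊢
  generalize aeval p (th (dih s d 0)) = θi at *
  generalize aeval p (th (dih s d 1)) = θj at *
  generalize aeval p (th (dih s d 2)) = θk at *
  generalize aeval p (th (dih s d 3)) = θl at *
  generalize aeval p (thpp (dih s d 2) (dih s d 3)) = θkl at *
  generalize aeval p (aPP (dih s d 0) (dih s d 1)) = Aij at *
  generalize aeval p (aPP (dih s d 1) (dih s d 2)) = Ajk at *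
  generalize aeval p (aPP (dih s d 2) (dih s d 3)) = Akl at *
  generalize aeval p (aPP (dih s d 3) (dih s d 0)) = Ali at *
  generalize aeval p (aS (dih s d 0)) = Ai at *
  generalize aeval p (aS (dih s d 1)) = Aj at *
  generalize aeval p (aS (dih s d 2)) = Ak at *
  generalize aeval p (aS (dih s d 3)) = Al at *
  refine (mul_eq_zero_iff_left hA).mp ?_
  linear_combination (-θkl) * e1 + θi * e3 + Ajk * Ak * θk * e4
    - aeval p (lam (dih s d 1)) * Aij * Ajk * Ali * e4' + Ajk * Ak * Akl * Al * Ali * e1'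

/-- Any two nonzero elements of a field extend to a point of the cluster variety with
prescribed coefficients. -/
theorem exists_point {x y : F} (hx : x ≠ 0) (hy : y ≠ 0) (a : Fin 18 → F) (ha : ∀ i, a i ≠ 0) :
    ∃ p : Fin 18 → F, p 0 = x ∧ p 1 = y ∧ (∀ i, 8 ≤ i → p i = a i) ∧
      ∀ m s d, aeval p (genG2 m s d) = 0 := by
  obtain ⟨z, hz⟩ : ∃ z, x * z = a 9 * y + a 11 * a 12 * a 13 ^ 2 * a 14 * a 15 :=
    ⟨_, mul_div_cancel₀ _ hx⟩
  obtain ⟨u, hu⟩ : ∃ u, y * u = a 11 * a 10 * z ^ 2 + a 17 * a 13 * a 15 * a 11 * z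
      + a 16 * a 15 ^ 2 * a 14 * a 13 ^ 2 * a 11 + a 8 * a 15 ^ 2 * a 14 * a 13 * x :=
    ⟨_, mul_div_cancel₀ _ hy⟩
  obtain ⟨w, hw⟩ : ∃ w, y * w = a 15 * a 8 * x ^ 2 + a 16 * a 11 * a 13 * a 15 * x
      + a 17 * a 11 ^ 2 * a 12 * a 13 ^ 2 * a 15 + a 10 * a 11 ^ 2 * a 12 * a 13 * z :=
    ⟨_, mul_div_cancel₀ _ hy⟩
  obtain ⟨r, hr⟩ : ∃ r, a 11 * r = z * u - a 13 * a 14 * a 15 ^ 2 * a 8 * a 9 :=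
    ⟨_, mul_div_cancel₀ _ (ha 11)⟩
  obtain ⟨q, hq⟩ : ∃ q, a 13 * q = u * w - a 15 * a 8 * a 9 ^ 2 * a 10 * a 11 :=
    ⟨_, mul_div_cancel₀ _ (ha 13)⟩
  obtain ⟨t, ht⟩ : ∃ t, a 15 * t = w * x - a 9 * a 10 * a 11 ^ 2 * a 12 * a 13 :=
    ⟨_, mul_div_cancel₀ _ (ha 15)⟩
  have e : x * u = a 9 * a 10 * a 11 * z + a 17 * a 9 * a 11 * a 13 * a 15
      + a 13 * a 14 * a 15 * w := by
    refine mul_left_cancel₀ hy ?_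
    linear_combination x * hu + (a 11 * a 10 * z + a 17 * a 13 * a 15 * a 11) * hz
      - a 13 * a 14 * a 15 * hw
  have e' : z * w = a 11 * a 12 * a 13 * u + a 16 * a 9 * a 11 * a 13 * a 15
      + a 15 * a 8 * a 9 * x := by
    refine mul_left_cancel₀ hy ?_
    linear_combination z * hw + (a 15 * a 8 * x + a 16 * a 11 * a 13 * a 15) * hz
      - a 11 * a 12 * a 13 * hu
  set p : Fin 18 → F := ![x, y, z, r, u, q, w, t, a 8, a 9, a 10, a 11, a 12, a 13, a 14, a 15,
    a 16, a 17] with hp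
  have h1 : ∀ s d, aeval p (f1 s d) = 0 := by
    intro s d
    fin_cases s <;> cases d <;>
      simp [f1, dih, th, aPP, aS, aP, thpp, thp, hp, show (-1 : Fin 4) = 3 from rfl,
        show (-2 : Fin 4) = 2 from rfl, show (-3 : Fin 4) = 1 from rfl] <;>
      first
        | linear_combination hz
        | linear_combination -hr
        | linear_combination -hq
        | linear_combination -ht
  have h4 : ∀ s d, aeval p (f4 s d) = 0 := by
    intro s d
    fin_cases s <;> cases d <;>
      simp [f4, dih, th, aPP, aS, aP, lam, hp, show (-1 : Fin 4) = 3 from rfl,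
        show (-2 : Fin 4) = 2 from rfl, show (-3 : Fin 4) = 1 from rfl] <;>
      first
        | linear_combination e
        | linear_combination e'
  have h0 : ∀ i, aeval p (aP i) ≠ 0 := by
    intro i
    fin_cases i <;> simp [aP, hp, ha]
  refine ⟨p, rfl, rfl, ?_, ?_⟩
  · intro i hi
    fin_cases i <;> first | rfl | simp at hi
  · intro m s d
    fin_cases m
    · exact h1 s d
    · exact aeval_f2_eq_zero h0 h1 h4 s d
    · exact aeval_f3_eq_zero h0 h1 h4 s d
    · exact h4 s d
    · exact aeval_f5_eq_zero h0 h1 h4 s d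

end Relations

section Valuation

/-- The exponent group: `ℤ¹⁸` with the lexicographic order. -/
abbrev ExpGroup : Type := Lex (Fin 18 → ℤ)

/-- `f` has finite order, with first two coordinates `m` and `n`. -/
def HasOrder (f : HahnSeries ExpGroup ℂ) (m n : ℤ) : Prop :=
  ∃ g : ExpGroup, HahnSeries.addVal ExpGroup ℂ f = g ∧ g 0 = m ∧ g 1 = n

namespace HasOrder

variable {f f' : HahnSeries ExpGroup ℂ} {m n m' n' : ℤ}

theorem ne_zero (h : HasOrder f m n) : f ≠ 0 := by
  rintro rfl
  obtain ⟨g, hg, -⟩ := h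
  simp at hg

theorem single (g : ExpGroup) {c : ℂ} (hc : c ≠ 0) :
    HasOrder (HahnSeries.single g c) (g 0) (g 1) :=
  ⟨g, by rw [HahnSeries.addVal_apply, HahnSeries.orderTop_single hc], rfl, rfl⟩

theorem mul (h : HasOrder f m n) (h' : HasOrder f' m' n') :
    HasOrder (f * f') (m + m') (n + n') := by
  obtain ⟨g, hg, rfl, rfl⟩ := h
  obtain ⟨g', hg', rfl, rfl⟩ := h'
  exact ⟨g + g', by rw [AddValuation.map_mul, hg, hg', WithTop.coe_add], rfl, rfl⟩

theorem pow (h : HasOrder f m n) (k : ℕ) : HasOrder (f ^ k) (k * m) (k * n) := by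
  obtain ⟨g, hg, rfl, rfl⟩ := h
  refine ⟨k • g, by rw [AddValuation.map_pow, hg, WithTop.coe_nsmul], ?_, ?_⟩
  · exact nsmul_eq_mul _ _
  · exact nsmul_eq_mul _ _

theorem neg (h : HasOrder f m n) : HasOrder (-f) m n := by
  obtain ⟨g, hg, h⟩ := h
  exact ⟨g, by rw [AddValuation.map_neg, hg], h⟩

theorem add (h : HasOrder f m n) (h' : HasOrder f' m' n') (hm : m < m') :
    HasOrder (f + f') m n := by
  obtain ⟨g, hg, rfl, rfl⟩ := h
  obtain ⟨g', hg', rfl, rfl⟩ := h'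
  refine ⟨g, ?_, rfl, rfl⟩
  rw [AddValuation.map_add_eq_of_lt_left, hg]
  rw [hg, hg', WithTop.coe_lt_coe]
  exact ⟨0, fun j hj => absurd hj (Fin.not_lt_zero j), hm⟩

theorem of_mul_eq {a b r : HahnSeries ExpGroup ℂ} {k l : ℤ} (ha : HasOrder a m n)
    (hr : HasOrder r k l) (h : a * b = r) : HasOrder b (k - m) (l - n) := by
  have hb : b ≠ 0 := by
    rintro rfl
    exact hr.ne_zero (by rw [← h, mul_zero])
  have hv := HahnSeries.addVal_apply_of_ne hb
  obtain ⟨g, hg, rfl, rfl⟩ := ha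
  obtain ⟨g', hg', rfl, rfl⟩ := hr
  rw [← h, AddValuation.map_mul, hg, hv, ← WithTop.coe_add, WithTop.coe_inj] at hg'
  subst hg'
  exact ⟨b.order, hv, (add_sub_cancel_left _ _).symm, (add_sub_cancel_left _ _).symm⟩

end HasOrder

/-- Series with pairwise distinct orders are linearly independent. -/
theorem sum_ne_zero_of_injOn_order {ι Γ : Type*} [AddCommGroup Γ] [LinearOrder Γ]
    [IsOrderedAddMonoid Γ] {S : Finset ι} (hS : S.Nonempty) {f : ι → HahnSeries Γ ℂ} {g : ι → Γ}
    (hf : ∀ i ∈ S, HahnSeries.addVal Γ ℂ (f i) = g i) (hg : Set.InjOn g S) :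
    ∑ i ∈ S, f i ≠ 0 := by
  classical
  obtain ⟨i, hi, hmin⟩ := S.exists_min_image g hS
  intro h0
  have h1 : HahnSeries.addVal Γ ℂ (f i) < HahnSeries.addVal Γ ℂ (∑ j ∈ S.erase i, f j) := by
    refine AddValuation.map_lt_sum _ ?_ fun j hj => ?_
    · rw [hf i hi]
      exact WithTop.coe_ne_top
    · obtain ⟨hne, hj⟩ := Finset.mem_erase.mp hj
      rw [hf i hi, hf j hj, WithTop.coe_lt_coe]
      exact (hmin j hj).lt_of_ne fun h => hne (hg hj hi h.symm)
  rw [← Finset.add_sum_erase S f hi, add_eq_zero_iff_neg_eq] at h0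
  rw [← h0, AddValuation.map_neg] at h1
  exact lt_irrefl _ h1

/-- The first coordinates of the orders of the 18 variables. -/
def orderFst : Fin 18 → ℤ := ![-1, 1, 1, -1, -2, -5, -3, -4, 0, 0, 0, 0, 0, 0, 0, 0, 0, 0]

/-- The second coordinates of the orders of the 18 variables. -/
def orderSnd : Fin 18 → ℤ := ![0, 1, 0, -1, -1, -2, -1, -1, 0, 0, 0, 0, 0, 0, 0, 0, 0, 0]

theorem exists_valued_point : ∃ (p : Fin 18 → HahnSeries ExpGroup ℂ) (W : Fin 18 → ExpGroup),
    (∀ m s d, aeval p (genG2 m s d) = 0) ∧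
    (∀ i, HahnSeries.addVal ExpGroup ℂ (p i) = W i) ∧
    (∀ i, W i 0 = orderFst i) ∧ (∀ i, W i 1 = orderSnd i) ∧
    ∀ i, 8 ≤ i → W i = toLex (Pi.single i 1) := by
  have hsingle (g : ExpGroup) : HasOrder (HahnSeries.single g (1 : ℂ)) (g 0) (g 1) :=
    HasOrder.single g one_ne_zero
  obtain ⟨p, h0, h1, hp, hrel⟩ := exists_point
    (hsingle (toLex (Pi.single 0 (-1)))).ne_zero
    (hsingle (toLex (Pi.single 0 1 + Pi.single 1 1))).ne_zero
    (fun i => HahnSeries.single (toLex (Pi.single i 1)) 1) (fun i => (hsingle _).ne_zero)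
  have k0 : HasOrder (p 0) (-1) 0 := h0 ▸ hsingle _
  have k1 : HasOrder (p 1) 1 1 := h1 ▸ hsingle _
  have kc (i : Fin 18) (hi : 8 ≤ i) : HasOrder (p i) 0 0 := by
    have h := hsingle (toLex (Pi.single i 1))
    rw [← hp i hi] at h
    have hi0 : i ≠ 0 := by rintro rfl; simp at hi
    have hi1 : i ≠ 1 := by rintro rfl; simp at hi
    simpa [Pi.single_apply, hi0.symm, hi1.symm] using h
  have k8 := kc 8 le_rfl
  have k9 := kc 9 (by decide)
  have k10 := kc 10 (by decide)
  have k11 := kc 11 (by decide)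
  have k12 := kc 12 (by decide)
  have k13 := kc 13 (by decide)
  have k14 := kc 14 (by decide)
  have k15 := kc 15 (by decide)
  have k16 := kc 16 (by decide)
  have k17 := kc 17 (by decide)
  have r2 := hrel 0 0 true
  have r3 := hrel 1 0 true
  have r4 := hrel 2 2 false
  have r5 := hrel 4 0 true
  have r6 := hrel 2 3 true
  have r7 := hrel 1 3 true
  simp [genG2, f1, f2, f3, f5, dih, th, aPP, aS, aP, thpp, thp, lam] at r2 r3 r4 r5 r6 r7
  have k2 : HasOrder (p 2) 1 0 :=
    k0.of_mul_eq ((((((k11.mul k12).mul (k13.pow 2)).mul k14).mul k15).add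
      (k9.mul k1) (by norm_num))) (by linear_combination r2)
  have k3 : HasOrder (p 3) (-1) (-1) :=
    k1.of_mul_eq ((((((k12.mul (k13.pow 3)).mul (k14.pow 2)).mul (k15.pow 3)).mul k8).add
      (k10.mul (k2.pow 3)) (by norm_num)).add
      (((k17.mul k13).mul k15).mul (k2.pow 2)) (by norm_num) |>.add
      ((((k16.mul (k13.pow 2)).mul k14).mul (k15.pow 2)).mul k2) (by norm_num))
      (by linear_combination r3)
  have k4 : HasOrder (p 4) (-2) (-1) :=
    k1.of_mul_eq (((((k8.mul (k15.pow 2)).mul k14).mul k13).mul k0).add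
      ((k11.mul k10).mul (k2.pow 2)) (by norm_num) |>.add
      ((((k17.mul k15).mul k13).mul k11).mul k2) (by norm_num) |>.add
      ((((k16.mul (k15.pow 2)).mul k14).mul (k13.pow 2)).mul k11) (by norm_num))
      (by linear_combination r4)
  have k6 : HasOrder (p 6) (-3) (-1) :=
    k1.of_mul_eq (((k15.mul k8).mul (k0.pow 2)).add
      ((((k16.mul k11).mul k13).mul k15).mul k0) (by norm_num) |>.add
      ((((k17.mul (k11.pow 2)).mul k12).mul (k13.pow 2)).mul k15) (by norm_num) |>.add
      ((((k10.mul (k11.pow 2)).mul k12).mul k13).mul k2) (by norm_num))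
      (by linear_combination r6)
  have k7 : HasOrder (p 7) (-4) (-1) :=
    k1.of_mul_eq ((k8.mul (k0.pow 3)).add
      (((k16.mul k11).mul k13).mul (k0.pow 2)) (by norm_num) |>.add
      ((((k17.mul (k11.pow 2)).mul k12).mul (k13.pow 2)).mul k0) (by norm_num) |>.add
      ((((k10.mul (k11.pow 3)).mul (k12.pow 2)).mul (k13.pow 3)).mul k14) (by norm_num))
      (by linear_combination r7)
  have k5 : HasOrder (p 5) (-5) (-2) :=
    k1.of_mul_eq (((((k14.mul (k15.pow 2)).mul k8).mul k6).mul k0).add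
      ((((k10.mul (k11.pow 2)).mul k12).mul k2).mul k4) (by norm_num) |>.add
      (((k15.mul k11).mul k16).mul (k0.mul k4)) (by norm_num) |>.add
      (((k15.mul k11).mul k17).mul (k2.mul k6)) (by norm_num) |>.add
      ((((k9.mul (k11.pow 2)).mul k13).mul (k15.pow 2)).mul (((k8.mul k10).mul k12).mul k14))
        (by norm_num) |>.add
      ((((k9.mul (k11.pow 2)).mul k13).mul (k15.pow 2)).mul (k16.mul k17)).neg (by norm_num))
      (by linear_combination r5)
  have k : ∀ i, HasOrder (p i) (orderFst i) (orderSnd i) := by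
    intro i
    fin_cases i <;> assumption
  choose W hW hW0 hW1 using k
  refine ⟨p, W, hrel, hW, hW0, hW1, fun i hi => ?_⟩
  have h := hW i
  rw [hp i hi, HahnSeries.addVal_apply, HahnSeries.orderTop_single one_ne_zero,
    WithTop.coe_inj] at h
  exact h.symm

end Valuation

section NormalForm

/-- The weights of the 18 variables: `3` for `θᵢ`, `5` for `θ_{ij}` and `0` for the
coefficients. -/
def varWeight : Fin 18 → ℕ := ![3, 5, 3, 5, 3, 5, 3, 5, 0, 0, 0, 0, 0, 0, 0, 0, 0, 0]

/-- The polynomials of weighted degree at most `n`. -/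
noncomputable def weightLE (n : ℕ) : Submodule ℂ R18 :=
  restrictSupport ℂ {s | Finsupp.weight varWeight s ≤ n}

theorem weightLE_mono {m n : ℕ} (h : m ≤ n) : weightLE m ≤ weightLE n :=
  restrictSupport_mono _ fun _ hs => le_trans hs h

theorem mul_mem_weightLE {m n : ℕ} {f g : R18} (hf : f ∈ weightLE m) (hg : g ∈ weightLE n) :
    f * g ∈ weightLE (m + n) := by
  have h := Submodule.mul_mem_mul hf hg
  rw [weightLE, weightLE, ← restrictSupport_add] at h
  refine restrictSupport_mono _ ?_ h
  rintro _ ⟨s, hs, t, ht, rfl⟩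
  simpa using add_le_add hs ht

theorem coeff_mul_mem_weightLE {n : ℕ} {f g : R18} (hf : f ∈ weightLE 0) (hg : g ∈ weightLE n) :
    f * g ∈ weightLE n := by
  simpa using mul_mem_weightLE hf hg

theorem coeff_pow_mem_weightLE {f : R18} (hf : f ∈ weightLE 0) (n : ℕ) : f ^ n ∈ weightLE 0 := by
  induction n with
  | zero =>
    rw [pow_zero, weightLE]
    exact (monomial_mem_restrictSupport ℂ (m := 0) (r := 1)).mpr (Or.inl (by simp))
  | succ n ih =>
    rw [pow_succ]
    exact coeff_mul_mem_weightLE ih hf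

theorem X_mem_weightLE {i : Fin 18} {n : ℕ} (h : varWeight i = n) : (X i : R18) ∈ weightLE n := by
  rw [weightLE, X, monomial_mem_restrictSupport]
  simp [Finsupp.weight_single, h]

theorem th_mem_weightLE (i : Fin 4) : th i ∈ weightLE 3 := by
  fin_cases i <;> exact X_mem_weightLE rfl

theorem thp_mem_weightLE (i : Fin 4) : thp i ∈ weightLE 5 := by
  fin_cases i <;> exact X_mem_weightLE rfl

theorem aS_mem_weightLE (i : Fin 4) : aS i ∈ weightLE 0 := by
  fin_cases i <;> exact X_mem_weightLE rfl

theorem aP_mem_weightLE (i : Fin 4) : aP i ∈ weightLE 0 := by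
  fin_cases i <;> exact X_mem_weightLE rfl

theorem lam_mem_weightLE (i : Fin 4) : lam i ∈ weightLE 0 := by
  fin_cases i <;> exact X_mem_weightLE rfl

theorem thpp_mem_weightLE (i j : Fin 4) : thpp i j ∈ weightLE 5 := by
  unfold thpp
  split_ifs <;> exact thp_mem_weightLE _

theorem aPP_mem_weightLE (i j : Fin 4) : aPP i j ∈ weightLE 0 := by
  unfold aPP
  split_ifs <;> exact aP_mem_weightLE _

theorem f1_reduction (s : Fin 4) (d : Bool) :
    th (dih s d 0) * th (dih s d 1) - f1 s d ∈ weightLE 5 := by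
  simp only [f1]
  generalize dih s d 0 = i
  generalize dih s d 1 = j
  generalize dih s d 2 = k
  generalize dih s d 3 = l
  have e : th i * th j - (th i * th j - aPP i j * thpp i j
      - aPP j k * aS k * aPP k l ^ 2 * aS l * aPP l i) =
      aPP i j * thpp i j + aPP j k * aS k * aPP k l ^ 2 * aS l * aPP l i := by ring
  rw [e]
  refine add_mem (coeff_mul_mem_weightLE (aPP_mem_weightLE _ _) (thpp_mem_weightLE _ _))
    (weightLE_mono (Nat.zero_le _) ?_)
  simp (maxDischargeDepth := 20) only [coeff_mul_mem_weightLE, coeff_pow_mem_weightLE,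
    aPP_mem_weightLE, aS_mem_weightLE]

theorem f2_reduction (s : Fin 4) (d : Bool) :
    thpp (dih s d 0) (dih s d 1) * thpp (dih s d 1) (dih s d 2) - f2 s d ∈ weightLE 9 := by
  simp only [f2]
  generalize dih s d 0 = i
  generalize dih s d 1 = j
  generalize dih s d 2 = k
  generalize dih s d 3 = l
  rw [← sub_add, ← sub_add, ← sub_add, ← sub_add, sub_self, zero_add, pow_succ _ 2, pow_two (th j)]
  have hj := th_mem_weightLE j
  have hj2 := mul_mem_weightLE hj hj
  have hj3 := mul_mem_weightLE hj2 hj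
  refine add_mem (add_mem (add_mem
    (coeff_mul_mem_weightLE ?_ hj3)
    (weightLE_mono (by norm_num) (coeff_mul_mem_weightLE ?_ hj2)))
    (weightLE_mono (by norm_num) (coeff_mul_mem_weightLE ?_ hj)))
    (weightLE_mono (Nat.zero_le _) ?_)
  all_goals simp (maxDischargeDepth := 20) only [coeff_mul_mem_weightLE, coeff_pow_mem_weightLE,
    aPP_mem_weightLE, aS_mem_weightLE, lam_mem_weightLE]

theorem f3_reduction (s : Fin 4) (d : Bool) :
    th (dih s d 0) * thpp (dih s d 1) (dih s d 2) - f3 s d ∈ weightLE 7 := by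
  simp only [f3]
  generalize dih s d 0 = i
  generalize dih s d 1 = j
  generalize dih s d 2 = k
  generalize dih s d 3 = l
  rw [← sub_add, ← sub_add, ← sub_add, ← sub_add, sub_self, zero_add, pow_two (th j)]
  have hj := th_mem_weightLE j
  refine add_mem (add_mem (add_mem
    (weightLE_mono (by norm_num) (coeff_mul_mem_weightLE ?_ (mul_mem_weightLE hj hj)))
    (weightLE_mono (by norm_num) (coeff_mul_mem_weightLE ?_ hj)))
    (weightLE_mono (Nat.zero_le _) ?_))
    (weightLE_mono (by norm_num) (coeff_mul_mem_weightLE ?_ (th_mem_weightLE k)))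
  all_goals simp (maxDischargeDepth := 20) only [coeff_mul_mem_weightLE, coeff_pow_mem_weightLE,
    aPP_mem_weightLE, aS_mem_weightLE, lam_mem_weightLE]

theorem f4_reduction (s : Fin 4) (d : Bool) :
    th (dih s d 0) * th (dih s d 2) - f4 s d ∈ weightLE 5 := by
  simp only [f4]
  generalize dih s d 0 = i
  generalize dih s d 1 = j
  generalize dih s d 2 = k
  generalize dih s d 3 = l
  rw [← sub_add, ← sub_add, ← sub_add, sub_self, zero_add]
  refine add_mem (add_mem
    (weightLE_mono (by norm_num) (coeff_mul_mem_weightLE ?_ (th_mem_weightLE j)))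
    (weightLE_mono (Nat.zero_le _) ?_))
    (weightLE_mono (by norm_num) (coeff_mul_mem_weightLE ?_ (th_mem_weightLE l)))
  all_goals simp (maxDischargeDepth := 20) only [coeff_mul_mem_weightLE,
    aPP_mem_weightLE, aS_mem_weightLE, lam_mem_weightLE]

theorem f5_reduction (s : Fin 4) (d : Bool) :
    thpp (dih s d 0) (dih s d 1) * thpp (dih s d 2) (dih s d 3) - f5 s d ∈ weightLE 9 := by
  simp only [f5]
  generalize dih s d 0 = i
  generalize dih s d 1 = j
  generalize dih s d 2 = k
  generalize dih s d 3 = l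
  rw [← sub_add, ← sub_add, ← sub_add, ← sub_add, sub_self, zero_add]
  have hth (i j : Fin 4) : th i * th j ∈ weightLE 6 :=
    mul_mem_weightLE (th_mem_weightLE i) (th_mem_weightLE j)
  simp only [mul_assoc _ (th _) (th _)]
  refine weightLE_mono (show 6 ≤ 9 by norm_num) (add_mem (add_mem (add_mem
    (coeff_mul_mem_weightLE ?_ (hth _ _))
    (coeff_mul_mem_weightLE ?_ (add_mem
      (coeff_mul_mem_weightLE ?_ (hth _ _)) (coeff_mul_mem_weightLE ?_ (hth _ _)))))
    (coeff_mul_mem_weightLE ?_ (hth _ _)))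
    (weightLE_mono (Nat.zero_le _) (coeff_mul_mem_weightLE ?_ (sub_mem ?_ ?_))))
  all_goals simp (maxDischargeDepth := 20) only [coeff_mul_mem_weightLE, coeff_pow_mem_weightLE,
    aPP_mem_weightLE, aS_mem_weightLE, lam_mem_weightLE]

/-- Two cluster variables, given by their indices in `R18`, that lie in no common cluster. -/
def Incompatible (a b : Fin 18) : Prop :=
  a.val < b.val ∧ b.val < 8 ∧ a.val + 1 ≠ b.val ∧ a.val + 7 ≠ b.val

instance (a b : Fin 18) : Decidable (Incompatible a b) :=
  inferInstanceAs (Decidable (_ ∧ _))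

/-- The product of two incompatible cluster variables is the leading term of a generator. -/
theorem exists_reduction {a b : Fin 18} (h : Incompatible a b) :
    ∃ m s d n, n < varWeight a + varWeight b ∧ X a * X b - genG2 m s d ∈ weightLE n := by
  obtain ⟨h1, h2, h3, h4⟩ := h
  have comm {f : R18} {n : ℕ} (h : X b * X a - f ∈ weightLE n) : X a * X b - f ∈ weightLE n := by
    rwa [mul_comm]
  obtain ⟨a, ha⟩ := a
  obtain ⟨b, hb⟩ := b
  simp only at h1 h2 h3 h4
  interval_cases b <;> interval_cases a <;> first | omega | skip
  · exact ⟨0, 0, true, 5, by simp [varWeight], f1_reduction 0 true⟩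
  · exact ⟨2, 0, true, 7, by simp [varWeight], f3_reduction 0 true⟩
  · exact ⟨1, 0, true, 9, by simp [varWeight], f2_reduction 0 true⟩
  · exact ⟨3, 0, true, 5, by simp [varWeight], f4_reduction 0 true⟩
  · exact ⟨2, 2, false, 7, by simp [varWeight], comm (f3_reduction 2 false)⟩
  · exact ⟨0, 1, true, 5, by simp [varWeight], f1_reduction 1 true⟩
  · exact ⟨2, 0, false, 7, by simp [varWeight], f3_reduction 0 false⟩
  · exact ⟨4, 0, true, 9, by simp [varWeight], f5_reduction 0 true⟩
  · exact ⟨2, 1, true, 7, by simp [varWeight], f3_reduction 1 true⟩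
  · exact ⟨1, 1, true, 9, by simp [varWeight], f2_reduction 1 true⟩
  · exact ⟨0, 3, true, 5, by simp [varWeight], comm (f1_reduction 3 true)⟩
  · exact ⟨2, 3, true, 7, by simp [varWeight], comm (f3_reduction 3 true)⟩
  · exact ⟨3, 1, true, 5, by simp [varWeight], f4_reduction 1 true⟩
  · exact ⟨2, 3, false, 7, by simp [varWeight], comm (f3_reduction 3 false)⟩
  · exact ⟨0, 2, true, 5, by simp [varWeight], f1_reduction 2 true⟩
  · exact ⟨1, 3, true, 9, by simp [varWeight], comm (f2_reduction 3 true)⟩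
  · exact ⟨2, 1, false, 7, by simp [varWeight], f3_reduction 1 false⟩
  · exact ⟨4, 1, true, 9, by simp [varWeight], f5_reduction 1 true⟩
  · exact ⟨2, 2, true, 7, by simp [varWeight], f3_reduction 2 true⟩
  · exact ⟨1, 2, true, 9, by simp [varWeight], f2_reduction 2 true⟩

theorem genG2_mem (m : Fin 5) (s : Fin 4) (d : Bool) : genG2 m s d ∈ IG2 :=
  Ideal.subset_span ⟨(m, s, d), rfl⟩

/-- The exponents of the standard monomials: those whose cluster variables are pairwise
compatible. -/
def standardExponents : Set (Fin 18 →₀ ℕ) :=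
  {s | ∀ a b, Incompatible a b → s a = 0 ∨ s b = 0}

theorem monomial_mem_sup_standard (s : Fin 18 →₀ ℕ) (c : ℂ) :
    (monomial s c : R18) ∈ IG2.restrictScalars ℂ ⊔ restrictSupport ℂ standardExponents := by
  induction hn : Finsupp.weight varWeight s using Nat.strong_induction_on generalizing s c with
  | _ n ih =>
  by_cases hs : s ∈ standardExponents
  · exact Submodule.mem_sup_right ((monomial_mem_restrictSupport ℂ).mpr (Or.inl hs))
  obtain ⟨a, b, hab, hsa, hsb⟩ : ∃ a b, Incompatible a b ∧ s a ≠ 0 ∧ s b ≠ 0 := by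
    simpa [standardExponents] using hs
  have hne : a ≠ b := fun h => by simp [Incompatible, h] at hab
  obtain ⟨t, rfl⟩ : ∃ t, s = t + (Finsupp.single a 1 + Finsupp.single b 1) := by
    refine ⟨s - (Finsupp.single a 1 + Finsupp.single b 1), (tsub_add_cancel_of_le ?_).symm⟩
    intro i
    rw [Finsupp.add_apply, Finsupp.single_apply, Finsupp.single_apply]
    split_ifs with h1 h2 h2
    · exact absurd (h1.trans h2.symm) hne
    · subst h1; omega
    · subst h2; omega
    · exact Nat.zero_le _
  obtain ⟨m, u, d, k, hk, hred⟩ := exists_reduction hab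
  have e : (monomial (t + (Finsupp.single a 1 + Finsupp.single b 1)) c : R18) =
      monomial t c * genG2 m u d + monomial t c * (X a * X b - genG2 m u d) := by
    rw [← mul_add, add_sub_cancel, X, X, monomial_mul, monomial_mul, mul_one, mul_one]
  rw [e]
  refine add_mem (Submodule.mem_sup_left (IG2.mul_mem_left _ (genG2_mem m u d))) ?_
  have ht : (monomial t c : R18) ∈ weightLE (Finsupp.weight varWeight t) :=
    (monomial_mem_restrictSupport ℂ).mpr (Or.inl (Set.mem_ofPred.mpr le_rfl))
  have hmem := mul_mem_weightLE ht hred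
  rw [weightLE, mem_restrictSupport_iff] at hmem
  rw [as_sum (monomial t c * (X a * X b - genG2 m u d))]
  refine sum_mem fun v hv => ih _ ?_ _ _ rfl
  have hv' : Finsupp.weight varWeight v ≤ _ := hmem hv
  simp only [map_add, Finsupp.weight_single, smul_eq_mul, one_mul] at hn
  omega

/-- Every polynomial is congruent modulo `IG2` to a combination of standard monomials. -/
theorem sup_standard_eq_top :
    IG2.restrictScalars ℂ ⊔ restrictSupport ℂ standardExponents = ⊤ := by
  refine eq_top_iff.mpr fun f _ => ?_
  rw [as_sum f]
  exact sum_mem fun s _ => monomial_mem_sup_standard s _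

end NormalForm

section Kernel

/-- The support of a standard exponent meets the cluster variables in a pair of cyclic
neighbours. -/
theorem standardExponents_support {s : Fin 18 →₀ ℕ} (hs : s ∈ standardExponents) :
    ∃ k : Fin 8, ∀ j : Fin 8, j ≠ k → j ≠ k + 1 → s (j.castLE (by norm_num)) = 0 := by
  have h (a b : Fin 18) (hab : Incompatible a b := by decide) : s a = 0 ∨ s b = 0 := hs a b hab
  by_contra! hc
  have h2 := h 0 2
  have h3 := h 0 3
  have h4 := h 0 4
  have h5 := h 0 5
  have h6 := h 0 6
  have h13 := h 1 3
  have h14 := h 1 4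
  have h15 := h 1 5
  have h16 := h 1 6
  have h17 := h 1 7
  have h24 := h 2 4
  have h25 := h 2 5
  have h26 := h 2 6
  have h27 := h 2 7
  have h35 := h 3 5
  have h36 := h 3 6
  have h37 := h 3 7
  have h46 := h 4 6
  have h47 := h 4 7
  have h57 := h 5 7
  simp only [Fin.forall_fin_succ, Fin.exists_fin_succ] at hc
  simp at hc
  grind

/-- The first two coordinates of the orders of the cluster variables span a complete
unimodular fan, so that exponents supported on cones are determined by their image. -/
theorem eq_of_sum_order_eq {s t : Fin 18 →₀ ℕ} (hs : s ∈ standardExponents)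
    (ht : t ∈ standardExponents)
    (h0 : ∑ i, (s i : ℤ) * orderFst i = ∑ i, (t i : ℤ) * orderFst i)
    (h1 : ∑ i, (s i : ℤ) * orderSnd i = ∑ i, (t i : ℤ) * orderSnd i) (j : Fin 8) :
    s (j.castLE (by norm_num)) = t (j.castLE (by norm_num)) := by
  obtain ⟨k, hk⟩ := standardExponents_support hs
  obtain ⟨l, hl⟩ := standardExponents_support ht
  simp only [orderFst, orderSnd, Fin.sum_univ_succ] at h0 h1
  simp at h0 h1
  revert j
  simp only [Fin.forall_fin_succ] at hk hl ⊢
  simp at hk hl ⊢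
  fin_cases k <;> fin_cases l <;> simp at hk hl <;>
    simp only [hk, hl, Nat.cast_zero, zero_mul, neg_zero, zero_add, add_zero, and_true,
      true_and] at h0 h1 ⊢ <;> omega

/-- A standard exponent is determined by the order of its monomial. -/
theorem standardExponents_injOn {W : Fin 18 → ExpGroup} (h0 : ∀ i, W i 0 = orderFst i)
    (h1 : ∀ i, W i 1 = orderSnd i) (hW : ∀ i, 8 ≤ i → W i = toLex (Pi.single i 1)) :
    Set.InjOn (fun s : Fin 18 →₀ ℕ => ∑ i, s i • W i) standardExponents := by
  intro s hs t ht hst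
  have key (j : Fin 18) : ∑ i, (s i : ℤ) * W i j = ∑ i, (t i : ℤ) * W i j := by
    have h := congrArg (Pi.evalAddMonoidHom (fun _ : Fin 18 => ℤ) j) hst
    have e (u : Fin 18 →₀ ℕ) : Pi.evalAddMonoidHom (fun _ : Fin 18 => ℤ) j (∑ i, u i • W i) =
        ∑ i, (u i : ℤ) * W i j :=
      (map_sum (Pi.evalAddMonoidHom (fun _ : Fin 18 => ℤ) j) _ _).trans
        (Finset.sum_congr rfl fun i _ => nsmul_eq_mul (u i) (W i j))
    exact (e s).symm.trans (h.trans (e t))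
  have hlow (i : Fin 18) (hi : ¬ 8 ≤ i) : s i = t i :=
    eq_of_sum_order_eq hs ht (by simpa only [h0] using key 0) (by simpa only [h1] using key 1)
      ⟨i, by omega⟩
  ext j
  by_cases hj : 8 ≤ j
  · have hkey : ∑ i, ((s i : ℤ) - t i) * W i j = 0 := by
      simp only [sub_mul, Finset.sum_sub_distrib, key, sub_self]
    rw [Finset.sum_eq_single j, hW j hj] at hkey
    · simpa [sub_eq_zero] using hkey
    · intro i _ hij
      by_cases hi : 8 ≤ i
      · simp [hW i hi, hij.symm]
      · simp [hlow i hi]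
    · simp
  · exact hlow j hj

/-- A polynomial in standard monomials that vanishes at a point with these orders is zero. -/
theorem eq_zero_of_standard {p : Fin 18 → HahnSeries ExpGroup ℂ} {W : Fin 18 → ExpGroup}
    (hp : ∀ i, HahnSeries.addVal ExpGroup ℂ (p i) = W i)
    (hinj : Set.InjOn (fun s : Fin 18 →₀ ℕ => ∑ i, s i • W i) standardExponents) {f : R18}
    (hf : f ∈ restrictSupport ℂ standardExponents) (h : aeval p f = 0) : f = 0 := by
  by_contra hne
  rw [mem_restrictSupport_iff] at hf
  rw [aeval_def, eval₂_eq'] at h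
  refine sum_ne_zero_of_injOn_order (support_nonempty.mpr hne) (fun s hs => ?_)
    (hinj.mono hf) h
  have hc : HahnSeries.addVal ExpGroup ℂ (algebraMap ℂ _ (coeff s f)) = 0 := by
    rw [HahnSeries.algebraMap_apply, HahnSeries.addVal_apply, HahnSeries.C_apply]
    exact HahnSeries.orderTop_single (mem_support_iff.mp hs)
  have hprod (S : Finset (Fin 18)) : HahnSeries.addVal ExpGroup ℂ (∏ i ∈ S, p i ^ s i) =
      ((∑ i ∈ S, s i • W i : ExpGroup) : WithTop ExpGroup) := by
    induction S using Finset.induction_on with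
    | empty => simp
    | insert i S hi ih =>
      rw [Finset.prod_insert hi, Finset.sum_insert hi, AddValuation.map_mul, AddValuation.map_pow,
        hp, ih, WithTop.coe_add, WithTop.coe_nsmul]
  rw [AddValuation.map_mul, hc, zero_add, hprod]

end Kernel

/-- The G₂ cluster ideal is a prime ideal of `R18`; equivalently, the
G₂ cluster variety is irreducible and its coordinate ring is an integral domain. -/
theorem IG2_isPrime : IG2.IsPrime := by
  obtain ⟨p, W, hrel, hp, h0, h1, hW⟩ := exists_valued_point
  have hle : IG2 ≤ RingHom.ker (aeval p : R18 →ₐ[ℂ] HahnSeries ExpGroup ℂ) := by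
    refine Ideal.span_le.mpr ?_
    rintro _ ⟨⟨m, s, d⟩, rfl⟩
    exact hrel m s d
  have hker : IG2 = RingHom.ker (aeval p : R18 →ₐ[ℂ] HahnSeries ExpGroup ℂ) := by
    refine le_antisymm hle fun f hf => ?_
    obtain ⟨g, hg, r, hr, rfl⟩ := Submodule.mem_sup.mp (sup_standard_eq_top ▸ Submodule.mem_top :
      f ∈ IG2.restrictScalars ℂ ⊔ restrictSupport ℂ standardExponents)
    have hg0 : aeval p g = 0 := hle hg
    have hr0 : aeval p r = 0 := by
      have h : aeval p (g + r) = 0 := hf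
      rwa [map_add, hg0, zero_add] at h
    rw [eq_zero_of_standard hp (standardExponents_injOn h0 h1 hW) hr hr0, add_zero]
    exact hg
  rw [hker]
  exact RingHom.ker_isPrime _
end

section
/- If p ∈ X_{G₂} ⊆ ℂ¹⁸ is a point at which at least one of the eight cluster coordinates θ₁, θ₁₂, θ₂, θ₂₃, θ₃, θ₃₄, θ₄, θ₄₁ is nonzero, then the 20×18 Jacobian matrix of the twenty generators of I_{G₂} evaluated at p has rank exactly 6; in other words, X_{G₂} is smooth at p, so the singular locus of X_{G₂} is contained in the deep locus X₀ = X_{G₂} ∩ V(θ₁, θ₁₂, θ₂, θ₂₃, θ₃, θ₃₄, θ₄, θ₄₁). -/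
/-!
The G₂ cluster variety.

`R18` is the polynomial ring over ℂ in the 18 variables, indexed as follows:
`0 ↦ θ₁, 1 ↦ θ₁₂, 2 ↦ θ₂, 3 ↦ θ₂₃, 4 ↦ θ₃, 5 ↦ θ₃₄, 6 ↦ θ₄, 7 ↦ θ₄₁,
 8 ↦ A₁, 9 ↦ A₁₂, 10 ↦ A₂, 11 ↦ A₂₃, 12 ↦ A₃, 13 ↦ A₃₄, 14 ↦ A₄, 15 ↦ A₄₁,
 16 ↦ λ₁₃, 17 ↦ λ₂₄`.
Indices `i : Fin 4` stand for the indices 1,2,3,4 taken modulo 4, with `Fin 4` addition.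
-/

open MvPolynomial

noncomputable section

/-- The Jacobian matrix of the generators of `IG2` (rows indexed by the generator family,
columns by the 18 variables), evaluated at `p ∈ ℂ¹⁸`.  Since permutations in the same
dihedral orbit give identical polynomials, its rows are exactly the rows of the 20×18
Jacobian matrix of the twenty generators (each appearing twice), so its rank equals the
rank of that 20×18 matrix. -/
def JacG2 (p : Fin 18 → ℂ) : Matrix (Fin 5 × Fin 4 × Bool) (Fin 18) ℂ :=
  Matrix.of fun a b => eval p (pderiv b (genG2 a.1 a.2.1 a.2.2))

end

open scoped Matrix in
/-- A matrix has rank `k` if it has a `k × k` lower triangular submatrix with nonzero diagonal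
whose rows have the same kernel as the whole matrix. -/
theorem Matrix.rank_eq_of_pivots {m n K : Type*} [Fintype m] [Fintype n] [Field K] {k : ℕ}
    (M : Matrix m n K) (r : Fin k → m) (c : Fin k → n)
    (htri : ∀ i j, i < j → M (r i) (c j) = 0) (hdiag : ∀ i, M (r i) (c i) ≠ 0)
    (hker : ∀ v, (∀ i, (M *ᵥ v) (r i) = 0) → M *ᵥ v = 0) : M.rank = k := by
  have htri' : (M.submatrix r c).IsLowerTriangular := fun i j hij => htri i j hij
  have hdet : IsUnit (M.submatrix r c).det := by
    rw [Matrix.det_of_isLowerTriangular _ htri', isUnit_iff_ne_zero]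
    exact Finset.prod_ne_zero_iff.mpr fun i _ => hdiag i
  have hN : (M.submatrix r id).rank = k := by
    refine le_antisymm ((Matrix.rank_le_card_height _).trans (by simp)) ?_
    calc k = ((M.submatrix r id).submatrix id c).rank := by
          rw [Matrix.submatrix_submatrix, Function.comp_id, Function.id_comp,
            Matrix.rank_of_isUnit _ ((Matrix.isUnit_iff_isUnit_det _).mpr hdet), Fintype.card_fin]
      _ ≤ (M.submatrix r id).rank := Matrix.rank_submatrix_le _ _ _
  have hk : LinearMap.ker M.mulVecLin = LinearMap.ker (M.submatrix r id).mulVecLin := by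
    ext v
    refine ⟨fun hv => ?_, fun hv => ?_⟩
    · ext i
      exact congrFun (LinearMap.mem_ker.mp hv) (r i)
    · exact hker v fun i => congrFun (LinearMap.mem_ker.mp hv) i
  have h₁ := LinearMap.finrank_range_add_finrank_ker M.mulVecLin
  have h₂ := LinearMap.finrank_range_add_finrank_ker (M.submatrix r id).mulVecLin
  rw [← hk] at h₂
  rw [← hN]
  unfold Matrix.rank
  omega

/-- Evaluation at a tangent vector `v` based at `p`. -/
theorem MvPolynomial.aeval_dualNumber {σ K : Type*} [Fintype σ] [CommRing K]
    (p v : σ → K) (f : MvPolynomial σ K) :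
    aeval (fun i => (TrivSqZeroExt.inl (p i) + TrivSqZeroExt.inr (v i) : DualNumber K)) f =
      TrivSqZeroExt.inl (eval p f) +
        TrivSqZeroExt.inr (∑ i, eval p (pderiv i f) * v i) := by
  classical
  induction f using MvPolynomial.induction_on with
  | C a => ext <;> simp [TrivSqZeroExt.algebraMap_eq_inl]
  | add f g hf hg =>
    rw [map_add, hf, hg]
    ext <;> simp [add_mul, Finset.sum_add_distrib]
  | mul_X f j hf =>
    rw [map_mul, hf]
    ext
    · simp
    · simp [Derivation.leibniz, add_mul, pderiv_X, Pi.single_apply, Finset.mul_sum, mul_comm,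
        mul_left_comm]
      simp [mul_add, Finset.sum_add_distrib, apply_ite (eval p), mul_left_comm, add_comm]

/-- The rotation `i ↦ i + 1` of the indices, acting on the 18 variables. -/
def rotG2 : Equiv.Perm (Fin 18) where
  toFun := ![2, 3, 4, 5, 6, 7, 0, 1, 10, 11, 12, 13, 14, 15, 8, 9, 17, 16]
  invFun := ![6, 7, 0, 1, 2, 3, 4, 5, 14, 15, 8, 9, 10, 11, 12, 13, 17, 16]
  left_inv := by decide
  right_inv := by decide

theorem rename_rotG2_genG2 (m : Fin 5) (s : Fin 4) (d : Bool) :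
    rename rotG2 (genG2 m s d) = genG2 m (s + 1) d := by
  have hth (i) : rename rotG2 (th i) = th (i + 1) := by fin_cases i <;> simp [th, rotG2]
  have hthp (i) : rename rotG2 (thp i) = thp (i + 1) := by fin_cases i <;> simp [thp, rotG2]
  have haS (i) : rename rotG2 (aS i) = aS (i + 1) := by fin_cases i <;> simp [aS, rotG2]
  have haP (i) : rename rotG2 (aP i) = aP (i + 1) := by fin_cases i <;> simp [aP, rotG2]
  have hlam (i) : rename rotG2 (lam i) = lam (i + 1) := by fin_cases i <;> simp [lam, rotG2]
  have hthpp (i j) : rename rotG2 (thpp i j) = thpp (i + 1) (j + 1) := by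
    simp only [thpp, add_left_inj, apply_ite (rename rotG2), hthp]
  have haPP (i j) : rename rotG2 (aPP i j) = aPP (i + 1) (j + 1) := by
    simp only [aPP, add_left_inj, apply_ite (rename rotG2), haP]
  have hdih (t) : dih (s + 1) d t = dih s d t + 1 := by
    cases d <;> simp [dih] <;> abel
  fin_cases m <;>
    simp [genG2, f1, f2, f3, f4, f5, hth, haS, hlam, hthpp, haPP, hdih]

theorem mem_XG2_comp_rotG2 {p : Fin 18 → ℂ} (hp : p ∈ XG2) : p ∘ rotG2 ∈ XG2 := fun m s d => by
  rw [← eval_rename, rename_rotG2_genG2]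
  exact hp m (s + 1) d

theorem rank_JacG2_comp_rotG2 (p : Fin 18 → ℂ) : (JacG2 (p ∘ rotG2)).rank = (JacG2 p).rank := by
  rw [← Matrix.rank_submatrix (JacG2 p)
    ((Equiv.refl _).prodCongr ((Equiv.addRight 1).prodCongr (Equiv.refl _))) rotG2]
  congr 1
  ext ⟨m, s, d⟩ b
  simp only [JacG2, Matrix.submatrix_apply, Matrix.of_apply, Equiv.prodCongr_apply, Prod.map_apply,
    Equiv.refl_apply, Equiv.coe_addRight]
  rw [← rename_rotG2_genG2, pderiv_rename rotG2.injective, eval_rename]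

/-- The twenty defining relations of the G₂ cluster variety, for elements of a commutative
ring; `μ` and `ν` stand for `λ₁₃` and `λ₂₄`, and `r_x_y` is the relation with leading term
`θ_x θ_y`. -/
structure G2Relations {R : Type*} [CommRing R]
    (θ₁ θ₁₂ θ₂ θ₂₃ θ₃ θ₃₄ θ₄ θ₄₁ A₁ A₁₂ A₂ A₂₃ A₃ A₃₄ A₄ A₄₁ μ ν : R) : Prop where
  r_1_2 : θ₁ * θ₂ - θ₁₂ * A₁₂ - A₂₃ * A₃ * A₃₄ ^ 2 * A₄ * A₄₁ = 0
  r_2_3 : θ₂ * θ₃ - θ₂₃ * A₂₃ - A₁ * A₁₂ * A₃₄ * A₄ * A₄₁ ^ 2 = 0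
  r_3_4 : θ₃ * θ₄ - θ₃₄ * A₃₄ - A₁ * A₁₂ ^ 2 * A₂ * A₂₃ * A₄₁ = 0
  r_1_4 : θ₁ * θ₄ - θ₄₁ * A₄₁ - A₁₂ * A₂ * A₂₃ ^ 2 * A₃ * A₃₄ = 0
  r_12_23 : θ₁₂ * θ₂₃ - θ₂ ^ 3 * A₂ - θ₂ ^ 2 * A₃₄ * A₄₁ * ν - θ₂ * A₃₄ ^ 2 * A₄ * A₄₁ ^ 2 * μ -
    A₁ * A₃ * A₃₄ ^ 3 * A₄ ^ 2 * A₄₁ ^ 3 = 0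
  r_23_34 : θ₂₃ * θ₃₄ - θ₃ ^ 3 * A₃ - θ₃ ^ 2 * A₁₂ * A₄₁ * μ - θ₃ * A₁ * A₁₂ ^ 2 * A₄₁ ^ 2 * ν -
    A₁ ^ 2 * A₁₂ ^ 3 * A₂ * A₄ * A₄₁ ^ 3 = 0
  r_34_41 : θ₃₄ * θ₄₁ - θ₄ ^ 3 * A₄ - θ₄ ^ 2 * A₁₂ * A₂₃ * ν - θ₄ * A₁₂ ^ 2 * A₂ * A₂₃ ^ 2 * μ -
    A₁ * A₁₂ ^ 3 * A₂ ^ 2 * A₂₃ ^ 3 * A₃ = 0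
  r_12_41 : θ₁₂ * θ₄₁ - θ₁ ^ 3 * A₁ - θ₁ ^ 2 * A₂₃ * A₃₄ * μ - θ₁ * A₂₃ ^ 2 * A₃ * A₃₄ ^ 2 * ν -
    A₂ * A₂₃ ^ 3 * A₃ ^ 2 * A₃₄ ^ 3 * A₄ = 0
  r_1_23 : θ₁ * θ₂₃ - θ₂ ^ 2 * A₁₂ * A₂ - θ₂ * A₁₂ * A₃₄ * A₄₁ * ν - θ₃ * A₃ * A₃₄ ^ 2 * A₄ *
    A₄₁ - A₁₂ * A₃₄ ^ 2 * A₄ * A₄₁ ^ 2 * μ = 0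
  r_2_34 : θ₂ * θ₃₄ - θ₃ ^ 2 * A₂₃ * A₃ - θ₃ * A₁₂ * A₂₃ * A₄₁ * μ - θ₄ * A₁ * A₁₂ * A₄ *
    A₄₁ ^ 2 - A₁ * A₁₂ ^ 2 * A₂₃ * A₄₁ ^ 2 * ν = 0
  r_3_41 : θ₃ * θ₄₁ - θ₁ * A₁ * A₁₂ ^ 2 * A₂ * A₂₃ - θ₄ ^ 2 * A₃₄ * A₄ - θ₄ * A₁₂ * A₂₃ * A₃₄ *
    ν - A₁₂ ^ 2 * A₂ * A₂₃ ^ 2 * A₃₄ * μ = 0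
  r_12_4 : θ₁₂ * θ₄ - θ₁ ^ 2 * A₁ * A₄₁ - θ₁ * A₂₃ * A₃₄ * A₄₁ * μ - θ₂ * A₂ * A₂₃ ^ 2 * A₃ *
    A₃₄ - A₂₃ ^ 2 * A₃ * A₃₄ ^ 2 * A₄₁ * ν = 0
  r_1_34 : θ₁ * θ₃₄ - θ₃ * A₁₂ * A₂ * A₂₃ ^ 2 * A₃ - θ₄ ^ 2 * A₄ * A₄₁ - θ₄ * A₁₂ * A₂₃ * A₄₁ *
    ν - A₁₂ ^ 2 * A₂ * A₂₃ ^ 2 * A₄₁ * μ = 0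
  r_2_41 : θ₂ * θ₄₁ - θ₁ ^ 2 * A₁ * A₁₂ - θ₁ * A₁₂ * A₂₃ * A₃₄ * μ - θ₄ * A₂₃ * A₃ * A₃₄ ^ 2 *
    A₄ - A₁₂ * A₂₃ ^ 2 * A₃ * A₃₄ ^ 2 * ν = 0
  r_12_3 : θ₁₂ * θ₃ - θ₁ * A₁ * A₃₄ * A₄ * A₄₁ ^ 2 - θ₂ ^ 2 * A₂ * A₂₃ - θ₂ * A₂₃ * A₃₄ * A₄₁ *
    ν - A₂₃ * A₃₄ ^ 2 * A₄ * A₄₁ ^ 2 * μ = 0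
  r_23_4 : θ₂₃ * θ₄ - θ₂ * A₁ * A₁₂ ^ 2 * A₂ * A₄₁ - θ₃ ^ 2 * A₃ * A₃₄ - θ₃ * A₁₂ * A₃₄ * A₄₁ *
    μ - A₁ * A₁₂ ^ 2 * A₃₄ * A₄₁ ^ 2 * ν = 0
  r_1_3 : θ₁ * θ₃ - θ₂ * A₁₂ * A₂ * A₂₃ - θ₄ * A₃₄ * A₄ * A₄₁ - A₁₂ * A₂₃ * A₃₄ * A₄₁ * ν = 0
  r_2_4 : θ₂ * θ₄ - θ₁ * A₁ * A₁₂ * A₄₁ - θ₃ * A₂₃ * A₃ * A₃₄ - A₁₂ * A₂₃ * A₃₄ * A₄₁ * μ = 0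
  r_12_34 : θ₁₂ * θ₃₄ - θ₁ * θ₃ * A₂₃ * A₄₁ * μ - θ₁ * θ₄ * A₁ * A₄ * A₄₁ ^ 2 - θ₂ * θ₃ * A₂ *
    A₂₃ ^ 2 * A₃ - θ₂ * θ₄ * A₂₃ * A₄₁ * ν - A₁ * A₁₂ * A₂ * A₂₃ ^ 2 * A₃ * A₃₄ * A₄ * A₄₁ ^ 2 +
    A₁₂ * A₂₃ ^ 2 * A₃₄ * A₄₁ ^ 2 * μ * ν = 0
  r_23_41 : θ₂₃ * θ₄₁ - θ₁ * θ₂ * A₁ * A₁₂ ^ 2 * A₂ - θ₁ * θ₃ * A₁₂ * A₃₄ * μ - θ₂ * θ₄ * A₁₂ *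
    A₃₄ * ν - θ₃ * θ₄ * A₃ * A₃₄ ^ 2 * A₄ - A₁ * A₁₂ ^ 2 * A₂ * A₂₃ * A₃ * A₃₄ ^ 2 * A₄ * A₄₁ +
    A₁₂ ^ 2 * A₂₃ * A₃₄ ^ 2 * A₄₁ * μ * ν = 0

/-- Where `θ₁₂` is invertible, the five relations with leading term divisible by
`θ₁₂` and the relation for `θ₁ θ₂` imply all the others. -/
theorem G2Relations.of_isUnit_θ₁₂ {R : Type*} [CommRing R]
    {θ₁ θ₁₂ θ₂ θ₂₃ θ₃ θ₃₄ θ₄ θ₄₁ A₁ A₁₂ A₂ A₂₃ A₃ A₃₄ A₄ A₄₁ μ ν : R}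
    (hu : IsUnit θ₁₂)
    (r_1_2 : θ₁ * θ₂ - θ₁₂ * A₁₂ - A₂₃ * A₃ * A₃₄ ^ 2 * A₄ * A₄₁ = 0)
    (r_12_23 : θ₁₂ * θ₂₃ - θ₂ ^ 3 * A₂ - θ₂ ^ 2 * A₃₄ * A₄₁ * ν - θ₂ * A₃₄ ^ 2 * A₄ * A₄₁ ^ 2 *
      μ - A₁ * A₃ * A₃₄ ^ 3 * A₄ ^ 2 * A₄₁ ^ 3 = 0)
    (r_12_41 : θ₁₂ * θ₄₁ - θ₁ ^ 3 * A₁ - θ₁ ^ 2 * A₂₃ * A₃₄ * μ - θ₁ * A₂₃ ^ 2 * A₃ * A₃₄ ^ 2 *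
      ν - A₂ * A₂₃ ^ 3 * A₃ ^ 2 * A₃₄ ^ 3 * A₄ = 0)
    (r_12_4 : θ₁₂ * θ₄ - θ₁ ^ 2 * A₁ * A₄₁ - θ₁ * A₂₃ * A₃₄ * A₄₁ * μ - θ₂ * A₂ * A₂₃ ^ 2 * A₃ *
      A₃₄ - A₂₃ ^ 2 * A₃ * A₃₄ ^ 2 * A₄₁ * ν = 0)
    (r_12_3 : θ₁₂ * θ₃ - θ₁ * A₁ * A₃₄ * A₄ * A₄₁ ^ 2 - θ₂ ^ 2 * A₂ * A₂₃ - θ₂ * A₂₃ * A₃₄ * A₄₁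
      * ν - A₂₃ * A₃₄ ^ 2 * A₄ * A₄₁ ^ 2 * μ = 0)
    (r_12_34 : θ₁₂ * θ₃₄ - θ₁ * θ₃ * A₂₃ * A₄₁ * μ - θ₁ * θ₄ * A₁ * A₄ * A₄₁ ^ 2 - θ₂ * θ₃ * A₂
      * A₂₃ ^ 2 * A₃ - θ₂ * θ₄ * A₂₃ * A₄₁ * ν - A₁ * A₁₂ * A₂ * A₂₃ ^ 2 * A₃ * A₃₄ * A₄ * A₄₁ ^ 2
      + A₁₂ * A₂₃ ^ 2 * A₃₄ * A₄₁ ^ 2 * μ * ν = 0) :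
    G2Relations θ₁ θ₁₂ θ₂ θ₂₃ θ₃ θ₃₄ θ₄ θ₄₁ A₁ A₁₂ A₂ A₂₃ A₃ A₃₄ A₄ A₄₁ μ ν := by
  have r_2_3 : θ₂ * θ₃ - θ₂₃ * A₂₃ - A₁ * A₁₂ * A₃₄ * A₄ * A₄₁ ^ 2 = 0 := by
    refine hu.mul_right_eq_zero.mp ?_
    linear_combination A₁ * A₃₄ * A₄ * A₄₁ ^ 2 * r_1_2 - A₂₃ * r_12_23 + θ₂ * r_12_3
  have r_1_4 : θ₁ * θ₄ - θ₄₁ * A₄₁ - A₁₂ * A₂ * A₂₃ ^ 2 * A₃ * A₃₄ = 0 := by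
    refine hu.mul_right_eq_zero.mp ?_
    linear_combination A₂ * A₂₃ ^ 2 * A₃ * A₃₄ * r_1_2 - A₄₁ * r_12_41 + θ₁ * r_12_4
  have r_1_3 : θ₁ * θ₃ - θ₂ * A₁₂ * A₂ * A₂₃ - θ₄ * A₃₄ * A₄ * A₄₁ - A₁₂ * A₂₃ * A₃₄ * A₄₁ * ν =
    0 := by
    refine hu.mul_right_eq_zero.mp ?_
    linear_combination (θ₂ * A₂ * A₂₃ + A₂₃ * A₃₄ * A₄₁ * ν) * r_1_2 + θ₁ * r_12_3 - A₃₄ * A₄ *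
      A₄₁ * r_12_4
  have r_2_4 : θ₂ * θ₄ - θ₁ * A₁ * A₁₂ * A₄₁ - θ₃ * A₂₃ * A₃ * A₃₄ - A₁₂ * A₂₃ * A₃₄ * A₄₁ * μ =
    0 := by
    refine hu.mul_right_eq_zero.mp ?_
    linear_combination (θ₁ * A₁ * A₄₁ + A₂₃ * A₃₄ * A₄₁ * μ) * r_1_2 - A₂₃ * A₃ * A₃₄ * r_12_3 +
      θ₂ * r_12_4
  have r_3_4 : θ₃ * θ₄ - θ₃₄ * A₃₄ - A₁ * A₁₂ ^ 2 * A₂ * A₂₃ * A₄₁ = 0 := by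
    refine hu.mul_right_eq_zero.mp ?_
    linear_combination A₁ * A₁₂ * A₂ * A₂₃ * A₄₁ * r_1_2 + θ₄ * r_12_3 - A₃₄ * r_12_34 - A₂₃ *
      A₃₄ * A₄₁ * μ * r_1_3 + θ₂ * A₂ * A₂₃ * r_2_4
  have r_1_23 : θ₁ * θ₂₃ - θ₂ ^ 2 * A₁₂ * A₂ - θ₂ * A₁₂ * A₃₄ * A₄₁ * ν - θ₃ * A₃ * A₃₄ ^ 2 * A₄
    * A₄₁ - A₁₂ * A₃₄ ^ 2 * A₄ * A₄₁ ^ 2 * μ = 0 := by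
    refine hu.mul_right_eq_zero.mp ?_
    linear_combination (θ₂ ^ 2 * A₂ + θ₂ * A₃₄ * A₄₁ * ν + A₃₄ ^ 2 * A₄ * A₄₁ ^ 2 * μ) * r_1_2 +
      θ₁ * r_12_23 - A₃ * A₃₄ ^ 2 * A₄ * A₄₁ * r_12_3
  have r_2_41 : θ₂ * θ₄₁ - θ₁ ^ 2 * A₁ * A₁₂ - θ₁ * A₁₂ * A₂₃ * A₃₄ * μ - θ₄ * A₂₃ * A₃ *
    A₃₄ ^ 2 * A₄ - A₁₂ * A₂₃ ^ 2 * A₃ * A₃₄ ^ 2 * ν = 0 := by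
    refine hu.mul_right_eq_zero.mp ?_
    linear_combination (θ₁ ^ 2 * A₁ + θ₁ * A₂₃ * A₃₄ * μ + A₂₃ ^ 2 * A₃ * A₃₄ ^ 2 * ν) * r_1_2 +
      θ₂ * r_12_41 - A₂₃ * A₃ * A₃₄ ^ 2 * A₄ * r_12_4
  have r_2_34 : θ₂ * θ₃₄ - θ₃ ^ 2 * A₂₃ * A₃ - θ₃ * A₁₂ * A₂₃ * A₄₁ * μ - θ₄ * A₁ * A₁₂ * A₄ *
    A₄₁ ^ 2 - A₁ * A₁₂ ^ 2 * A₂₃ * A₄₁ ^ 2 * ν = 0 := by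
    refine hu.mul_right_eq_zero.mp ?_
    linear_combination (θ₃ * A₂₃ * A₄₁ * μ + θ₄ * A₁ * A₄ * A₄₁ ^ 2 + A₁ * A₁₂ * A₂₃ * A₄₁ ^ 2 *
      ν) * r_1_2 - θ₃ * A₂₃ * A₃ * r_12_3 + θ₂ * r_12_34 - A₁ * A₂₃ * A₃ * A₃₄ * A₄ * A₄₁ ^ 2 *
      r_1_3 + θ₂ * A₂₃ * A₄₁ * ν * r_2_4
  have r_1_34 : θ₁ * θ₃₄ - θ₃ * A₁₂ * A₂ * A₂₃ ^ 2 * A₃ - θ₄ ^ 2 * A₄ * A₄₁ - θ₄ * A₁₂ * A₂₃ *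
    A₄₁ * ν - A₁₂ ^ 2 * A₂ * A₂₃ ^ 2 * A₄₁ * μ = 0 := by
    refine hu.mul_right_eq_zero.mp ?_
    linear_combination (θ₃ * A₂ * A₂₃ ^ 2 * A₃ + θ₄ * A₂₃ * A₄₁ * ν + A₁₂ * A₂ * A₂₃ ^ 2 * A₄₁ *
      μ) * r_1_2 - θ₄ * A₄ * A₄₁ * r_12_4 + θ₁ * r_12_34 + θ₁ * A₂₃ * A₄₁ * μ * r_1_3 - A₂ *
      A₂₃ ^ 2 * A₃ * A₃₄ * A₄ * A₄₁ * r_2_4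
  have r_3_41 : θ₃ * θ₄₁ - θ₁ * A₁ * A₁₂ ^ 2 * A₂ * A₂₃ - θ₄ ^ 2 * A₃₄ * A₄ - θ₄ * A₁₂ * A₂₃ *
    A₃₄ * ν - A₁₂ ^ 2 * A₂ * A₂₃ ^ 2 * A₃₄ * μ = 0 := by
    refine hu.mul_right_eq_zero.mp ?_
    linear_combination (θ₁ * A₁ * A₁₂ * A₂ * A₂₃ + θ₄ * A₂₃ * A₃₄ * ν + A₁₂ * A₂ * A₂₃ ^ 2 * A₃₄
      * μ) * r_1_2 + θ₃ * r_12_41 - θ₄ * A₃₄ * A₄ * r_12_4 - θ₂ * A₂₃ * A₃₄ * ν * r_1_4 + (θ₁ ^ 2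
      * A₁ + θ₁ * A₂₃ * A₃₄ * μ + A₂₃ ^ 2 * A₃ * A₃₄ ^ 2 * ν) * r_1_3 - A₂ * A₂₃ ^ 2 * A₃ *
      A₃₄ ^ 2 * A₄ * r_2_4 - A₂₃ * A₃₄ * A₄₁ * ν * r_2_41
  have r_23_4 : θ₂₃ * θ₄ - θ₂ * A₁ * A₁₂ ^ 2 * A₂ * A₄₁ - θ₃ ^ 2 * A₃ * A₃₄ - θ₃ * A₁₂ * A₃₄ *
    A₄₁ * μ - A₁ * A₁₂ ^ 2 * A₃₄ * A₄₁ ^ 2 * ν = 0 := by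
    refine hu.mul_right_eq_zero.mp ?_
    linear_combination (θ₂ * A₁ * A₁₂ * A₂ * A₄₁ + θ₃ * A₃₄ * A₄₁ * μ + A₁ * A₁₂ * A₃₄ * A₄₁ ^ 2
      * ν) * r_1_2 + θ₄ * r_12_23 - θ₃ * A₃ * A₃₄ * r_12_3 - θ₁ * A₃₄ * A₄₁ * μ * r_2_3 - A₁ * A₃
      * A₃₄ ^ 2 * A₄ * A₄₁ ^ 2 * r_1_3 + (θ₂ ^ 2 * A₂ + θ₂ * A₃₄ * A₄₁ * ν + A₃₄ ^ 2 * A₄ *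
      A₄₁ ^ 2 * μ) * r_2_4 - A₂₃ * A₃₄ * A₄₁ * μ * r_1_23
  have r_23_41 : θ₂₃ * θ₄₁ - θ₁ * θ₂ * A₁ * A₁₂ ^ 2 * A₂ - θ₁ * θ₃ * A₁₂ * A₃₄ * μ - θ₂ * θ₄ *
    A₁₂ * A₃₄ * ν - θ₃ * θ₄ * A₃ * A₃₄ ^ 2 * A₄ - A₁ * A₁₂ ^ 2 * A₂ * A₂₃ * A₃ * A₃₄ ^ 2 * A₄ *
    A₄₁ + A₁₂ ^ 2 * A₂₃ * A₃₄ ^ 2 * A₄₁ * μ * ν = 0 := by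
    refine hu.mul_right_eq_zero.mp ?_
    linear_combination (θ₁ * θ₂ * A₁ * A₁₂ * A₂ + θ₁ * θ₃ * A₃₄ * μ + θ₂ * θ₄ * A₃₄ * ν + A₁ *
      A₁₂ * A₂ * A₂₃ * A₃ * A₃₄ ^ 2 * A₄ * A₄₁ - A₁₂ * A₂₃ * A₃₄ ^ 2 * A₄₁ * μ * ν) * r_1_2 + θ₄₁
      * r_12_23 - θ₄ * A₃ * A₃₄ ^ 2 * A₄ * r_12_3 - θ₁ ^ 2 * A₃₄ * μ * r_2_3 + (-θ₂ ^ 2 * A₃₄ * ν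
      - A₁ * A₃ * A₃₄ ^ 3 * A₄ ^ 2 * A₄₁ ^ 2) * r_1_4 - θ₁ * A₂₃ * A₃₄ * μ * r_1_23 + (θ₂ ^ 2 * A₂
      + A₃₄ ^ 2 * A₄ * A₄₁ ^ 2 * μ) * r_2_41
  have r_23_34 : θ₂₃ * θ₃₄ - θ₃ ^ 3 * A₃ - θ₃ ^ 2 * A₁₂ * A₄₁ * μ - θ₃ * A₁ * A₁₂ ^ 2 * A₄₁ ^ 2
    * ν - A₁ ^ 2 * A₁₂ ^ 3 * A₂ * A₄ * A₄₁ ^ 3 = 0 := by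
    refine hu.mul_right_eq_zero.mp ?_
    linear_combination (θ₃ ^ 2 * A₄₁ * μ + θ₃ * A₁ * A₁₂ * A₄₁ ^ 2 * ν + A₁ ^ 2 * A₁₂ ^ 2 * A₂ *
      A₄ * A₄₁ ^ 3) * r_1_2 + θ₃₄ * r_12_23 - θ₃ ^ 2 * A₃ * r_12_3 + (-θ₁ * θ₃ * A₄₁ * μ - θ₁ * A₁
      * A₁₂ * A₄₁ ^ 2 * ν + θ₂ * A₁₂ * A₂ * A₂₃ * A₄₁ * μ + A₁₂ * A₂₃ * A₃₄ * A₄₁ ^ 2 * μ * ν) *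
      r_2_3 + (-θ₂₃ * A₂₃ * A₄₁ * μ - θ₃ * A₁ * A₃ * A₃₄ * A₄ * A₄₁ ^ 2 - A₁ * A₁₂ * A₃₄ * A₄ *
      A₄₁ ^ 3 * μ) * r_1_3 - A₁ * A₃ * A₃₄ ^ 2 * A₄ ^ 2 * A₄₁ ^ 3 * r_3_4 - A₁ * A₁₂ * A₂₃ *
      A₄₁ ^ 2 * ν * r_1_23 + (θ₂ ^ 2 * A₂ + θ₂ * A₃₄ * A₄₁ * ν + A₃₄ ^ 2 * A₄ * A₄₁ ^ 2 * μ) *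
      r_2_34 + (θ₂ * A₁ * A₁₂ * A₂ * A₄ * A₄₁ ^ 2 + A₁ * A₁₂ * A₃₄ * A₄ * A₄₁ ^ 3 * ν) * r_2_4 -
      A₂₃ * A₃₄ * A₄ * A₄₁ ^ 2 * μ * r_23_4
  have r_34_41 : θ₃₄ * θ₄₁ - θ₄ ^ 3 * A₄ - θ₄ ^ 2 * A₁₂ * A₂₃ * ν - θ₄ * A₁₂ ^ 2 * A₂ * A₂₃ ^ 2
    * μ - A₁ * A₁₂ ^ 3 * A₂ ^ 2 * A₂₃ ^ 3 * A₃ = 0 := by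
    refine hu.mul_right_eq_zero.mp ?_
    linear_combination (θ₄ ^ 2 * A₂₃ * ν + θ₄ * A₁₂ * A₂ * A₂₃ ^ 2 * μ + A₁ * A₁₂ ^ 2 * A₂ ^ 2 *
      A₂₃ ^ 3 * A₃) * r_1_2 + θ₃₄ * r_12_41 - θ₄ ^ 2 * A₄ * r_12_4 + (θ₁ * A₁ * A₁₂ * A₂₃ * A₄₁ *
      ν - θ₂ * θ₄ * A₂₃ * ν - θ₂ * A₁₂ * A₂ * A₂₃ ^ 2 * μ + A₁₂ * A₂₃ ^ 2 * A₃₄ * A₄₁ * μ * ν) *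
      r_1_4 + (-θ₄ * A₂ * A₂₃ ^ 2 * A₃ * A₃₄ * A₄ - θ₄₁ * A₂₃ * A₄₁ * ν - A₁₂ * A₂ * A₂₃ ^ 3 * A₃
      * A₃₄ * ν) * r_2_4 - A₂ * A₂₃ ^ 3 * A₃ ^ 2 * A₃₄ ^ 2 * A₄ * r_3_4 - A₁₂ * A₂ * A₂₃ ^ 2 * A₄₁
      * μ * r_2_41 + (θ₁ ^ 2 * A₁ + θ₁ * A₂₃ * A₃₄ * μ + A₂₃ ^ 2 * A₃ * A₃₄ ^ 2 * ν) * r_1_34 +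
      (θ₁ * A₁ * A₁₂ * A₂ * A₂₃ ^ 2 * A₃ + A₁₂ * A₂ * A₂₃ ^ 3 * A₃ * A₃₄ * μ) * r_1_3 - A₂₃ ^ 2 *
      A₃ * A₃₄ * A₄₁ * ν * r_3_41
  exact ⟨r_1_2, r_2_3, r_3_4, r_1_4, r_12_23, r_23_34, r_34_41, r_12_41, r_1_23, r_2_34, r_3_41,
      r_12_4, r_1_34, r_2_41, r_12_3, r_23_4, r_1_3, r_2_4, r_12_34, r_23_41⟩

/-- Where `θ₁` is invertible, the five relations with leading term divisible by
`θ₁` and the relation for `θ₁₂ θ₄₁` imply all the others. -/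
theorem G2Relations.of_isUnit_θ₁ {R : Type*} [CommRing R]
    {θ₁ θ₁₂ θ₂ θ₂₃ θ₃ θ₃₄ θ₄ θ₄₁ A₁ A₁₂ A₂ A₂₃ A₃ A₃₄ A₄ A₄₁ μ ν : R}
    (hu : IsUnit θ₁)
    (r_1_2 : θ₁ * θ₂ - θ₁₂ * A₁₂ - A₂₃ * A₃ * A₃₄ ^ 2 * A₄ * A₄₁ = 0)
    (r_1_4 : θ₁ * θ₄ - θ₄₁ * A₄₁ - A₁₂ * A₂ * A₂₃ ^ 2 * A₃ * A₃₄ = 0)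
    (r_12_41 : θ₁₂ * θ₄₁ - θ₁ ^ 3 * A₁ - θ₁ ^ 2 * A₂₃ * A₃₄ * μ - θ₁ * A₂₃ ^ 2 * A₃ * A₃₄ ^ 2 *
      ν - A₂ * A₂₃ ^ 3 * A₃ ^ 2 * A₃₄ ^ 3 * A₄ = 0)
    (r_1_23 : θ₁ * θ₂₃ - θ₂ ^ 2 * A₁₂ * A₂ - θ₂ * A₁₂ * A₃₄ * A₄₁ * ν - θ₃ * A₃ * A₃₄ ^ 2 * A₄ *
      A₄₁ - A₁₂ * A₃₄ ^ 2 * A₄ * A₄₁ ^ 2 * μ = 0)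
    (r_1_34 : θ₁ * θ₃₄ - θ₃ * A₁₂ * A₂ * A₂₃ ^ 2 * A₃ - θ₄ ^ 2 * A₄ * A₄₁ - θ₄ * A₁₂ * A₂₃ * A₄₁
      * ν - A₁₂ ^ 2 * A₂ * A₂₃ ^ 2 * A₄₁ * μ = 0)
    (r_1_3 : θ₁ * θ₃ - θ₂ * A₁₂ * A₂ * A₂₃ - θ₄ * A₃₄ * A₄ * A₄₁ - A₁₂ * A₂₃ * A₃₄ * A₄₁ * ν =
      0) :
    G2Relations θ₁ θ₁₂ θ₂ θ₂₃ θ₃ θ₃₄ θ₄ θ₄₁ A₁ A₁₂ A₂ A₂₃ A₃ A₃₄ A₄ A₄₁ μ ν := by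
  have r_12_4 : θ₁₂ * θ₄ - θ₁ ^ 2 * A₁ * A₄₁ - θ₁ * A₂₃ * A₃₄ * A₄₁ * μ - θ₂ * A₂ * A₂₃ ^ 2 * A₃
    * A₃₄ - A₂₃ ^ 2 * A₃ * A₃₄ ^ 2 * A₄₁ * ν = 0 := by
    refine hu.mul_right_eq_zero.mp ?_
    linear_combination (-A₂ * A₂₃ ^ 2 * A₃ * A₃₄) * r_1_2 + θ₁₂ * r_1_4 + A₄₁ * r_12_41
  have r_2_41 : θ₂ * θ₄₁ - θ₁ ^ 2 * A₁ * A₁₂ - θ₁ * A₁₂ * A₂₃ * A₃₄ * μ - θ₄ * A₂₃ * A₃ *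
    A₃₄ ^ 2 * A₄ - A₁₂ * A₂₃ ^ 2 * A₃ * A₃₄ ^ 2 * ν = 0 := by
    refine hu.mul_right_eq_zero.mp ?_
    linear_combination θ₄₁ * r_1_2 - A₂₃ * A₃ * A₃₄ ^ 2 * A₄ * r_1_4 + A₁₂ * r_12_41
  have r_2_4 : θ₂ * θ₄ - θ₁ * A₁ * A₁₂ * A₄₁ - θ₃ * A₂₃ * A₃ * A₃₄ - A₁₂ * A₂₃ * A₃₄ * A₄₁ * μ =
    0 := by
    refine hu.mul_right_eq_zero.mp ?_
    linear_combination θ₄ * r_1_2 - A₂₃ * A₃ * A₃₄ * r_1_3 + A₁₂ * r_12_4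
  have r_3_41 : θ₃ * θ₄₁ - θ₁ * A₁ * A₁₂ ^ 2 * A₂ * A₂₃ - θ₄ ^ 2 * A₃₄ * A₄ - θ₄ * A₁₂ * A₂₃ *
    A₃₄ * ν - A₁₂ ^ 2 * A₂ * A₂₃ ^ 2 * A₃₄ * μ = 0 := by
    refine hu.mul_right_eq_zero.mp ?_
    linear_combination (-θ₄ * A₃₄ * A₄ - A₁₂ * A₂₃ * A₃₄ * ν) * r_1_4 + θ₄₁ * r_1_3 + A₁₂ * A₂ *
      A₂₃ * r_2_41
  have r_3_4 : θ₃ * θ₄ - θ₃₄ * A₃₄ - A₁ * A₁₂ ^ 2 * A₂ * A₂₃ * A₄₁ = 0 := by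
    refine hu.mul_right_eq_zero.mp ?_
    linear_combination θ₃ * r_1_4 - A₃₄ * r_1_34 + A₄₁ * r_3_41
  have r_12_3 : θ₁₂ * θ₃ - θ₁ * A₁ * A₃₄ * A₄ * A₄₁ ^ 2 - θ₂ ^ 2 * A₂ * A₂₃ - θ₂ * A₂₃ * A₃₄ *
    A₄₁ * ν - A₂₃ * A₃₄ ^ 2 * A₄ * A₄₁ ^ 2 * μ = 0 := by
    refine hu.mul_right_eq_zero.mp ?_
    linear_combination (-θ₂ * A₂ * A₂₃ - A₂₃ * A₃₄ * A₄₁ * ν) * r_1_2 + θ₁₂ * r_1_3 + A₃₄ * A₄ *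
      A₄₁ * r_12_4
  have r_2_3 : θ₂ * θ₃ - θ₂₃ * A₂₃ - A₁ * A₁₂ * A₃₄ * A₄ * A₄₁ ^ 2 = 0 := by
    refine hu.mul_right_eq_zero.mp ?_
    linear_combination θ₃ * r_1_2 - A₂₃ * r_1_23 + A₁₂ * r_12_3
  have r_12_23 : θ₁₂ * θ₂₃ - θ₂ ^ 3 * A₂ - θ₂ ^ 2 * A₃₄ * A₄₁ * ν - θ₂ * A₃₄ ^ 2 * A₄ * A₄₁ ^ 2
    * μ - A₁ * A₃ * A₃₄ ^ 3 * A₄ ^ 2 * A₄₁ ^ 3 = 0 := by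
    refine hu.mul_right_eq_zero.mp ?_
    linear_combination (-θ₂ ^ 2 * A₂ - θ₂ * A₃₄ * A₄₁ * ν - A₃₄ ^ 2 * A₄ * A₄₁ ^ 2 * μ) * r_1_2
      + θ₁₂ * r_1_23 + A₃ * A₃₄ ^ 2 * A₄ * A₄₁ * r_12_3
  have r_34_41 : θ₃₄ * θ₄₁ - θ₄ ^ 3 * A₄ - θ₄ ^ 2 * A₁₂ * A₂₃ * ν - θ₄ * A₁₂ ^ 2 * A₂ * A₂₃ ^ 2
    * μ - A₁ * A₁₂ ^ 3 * A₂ ^ 2 * A₂₃ ^ 3 * A₃ = 0 := by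
    refine hu.mul_right_eq_zero.mp ?_
    linear_combination (-θ₄ ^ 2 * A₄ - θ₄ * A₁₂ * A₂₃ * ν - A₁₂ ^ 2 * A₂ * A₂₃ ^ 2 * μ) * r_1_4
      + θ₄₁ * r_1_34 + A₁₂ * A₂ * A₂₃ ^ 2 * A₃ * r_3_41
  have r_12_34 : θ₁₂ * θ₃₄ - θ₁ * θ₃ * A₂₃ * A₄₁ * μ - θ₁ * θ₄ * A₁ * A₄ * A₄₁ ^ 2 - θ₂ * θ₃ *
    A₂ * A₂₃ ^ 2 * A₃ - θ₂ * θ₄ * A₂₃ * A₄₁ * ν - A₁ * A₁₂ * A₂ * A₂₃ ^ 2 * A₃ * A₃₄ * A₄ *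
    A₄₁ ^ 2 + A₁₂ * A₂₃ ^ 2 * A₃₄ * A₄₁ ^ 2 * μ * ν = 0 := by
    refine hu.mul_right_eq_zero.mp ?_
    linear_combination (-θ₃ * A₂ * A₂₃ ^ 2 * A₃ - θ₄ * A₂₃ * A₄₁ * ν - A₁₂ * A₂ * A₂₃ ^ 2 * A₄₁
      * μ) * r_1_2 - θ₁ * A₂₃ * A₄₁ * μ * r_1_3 + θ₁₂ * r_1_34 + θ₄ * A₄ * A₄₁ * r_12_4 + A₂ *
      A₂₃ ^ 2 * A₃ * A₃₄ * A₄ * A₄₁ * r_2_4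
  have r_2_34 : θ₂ * θ₃₄ - θ₃ ^ 2 * A₂₃ * A₃ - θ₃ * A₁₂ * A₂₃ * A₄₁ * μ - θ₄ * A₁ * A₁₂ * A₄ *
    A₄₁ ^ 2 - A₁ * A₁₂ ^ 2 * A₂₃ * A₄₁ ^ 2 * ν = 0 := by
    refine hu.mul_right_eq_zero.mp ?_
    linear_combination θ₃₄ * r_1_2 - θ₃ * A₂₃ * A₃ * r_1_3 - A₂₃ * A₃ * A₃₄ * A₄ * A₄₁ * r_3_4 +
      A₁₂ * r_12_34 + A₁₂ * A₂₃ * A₄₁ * ν * r_2_4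
  have r_23_34 : θ₂₃ * θ₃₄ - θ₃ ^ 3 * A₃ - θ₃ ^ 2 * A₁₂ * A₄₁ * μ - θ₃ * A₁ * A₁₂ ^ 2 * A₄₁ ^ 2
    * ν - A₁ ^ 2 * A₁₂ ^ 3 * A₂ * A₄ * A₄₁ ^ 3 = 0 := by
    refine hu.mul_right_eq_zero.mp ?_
    linear_combination (-θ₃ ^ 2 * A₃ - θ₃ * A₁₂ * A₄₁ * μ - A₁ * A₁₂ ^ 2 * A₄₁ ^ 2 * ν) * r_1_3
      + θ₃₄ * r_1_23 + (-θ₃ * A₃ * A₃₄ * A₄ * A₄₁ - A₁₂ * A₃₄ * A₄ * A₄₁ ^ 2 * μ) * r_3_4 + (θ₂ *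
      A₁₂ * A₂ + A₁₂ * A₃₄ * A₄₁ * ν) * r_2_34 + A₁ * A₁₂ ^ 2 * A₂ * A₄ * A₄₁ ^ 2 * r_2_4
  have r_23_41 : θ₂₃ * θ₄₁ - θ₁ * θ₂ * A₁ * A₁₂ ^ 2 * A₂ - θ₁ * θ₃ * A₁₂ * A₃₄ * μ - θ₂ * θ₄ *
    A₁₂ * A₃₄ * ν - θ₃ * θ₄ * A₃ * A₃₄ ^ 2 * A₄ - A₁ * A₁₂ ^ 2 * A₂ * A₂₃ * A₃ * A₃₄ ^ 2 * A₄ *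
    A₄₁ + A₁₂ ^ 2 * A₂₃ * A₃₄ ^ 2 * A₄₁ * μ * ν = 0 := by
    refine hu.mul_right_eq_zero.mp ?_
    linear_combination (-θ₄ * A₁₂ * A₃₄ * ν) * r_1_2 + (-θ₃ * A₃ * A₃₄ ^ 2 * A₄ - A₁₂ * A₃₄ ^ 2
      * A₄ * A₄₁ * μ) * r_1_4 - θ₁ * A₁₂ * A₃₄ * μ * r_1_3 + θ₄₁ * r_1_23 - A₁₂ ^ 2 * A₃₄ * ν *
      r_12_4 + (θ₂ * A₁₂ * A₂ + A₁₂ * A₃₄ * A₄₁ * ν) * r_2_41 + A₁₂ * A₂ * A₂₃ * A₃ * A₃₄ ^ 2 * A₄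
      * r_2_4
  have r_23_4 : θ₂₃ * θ₄ - θ₂ * A₁ * A₁₂ ^ 2 * A₂ * A₄₁ - θ₃ ^ 2 * A₃ * A₃₄ - θ₃ * A₁₂ * A₃₄ *
    A₄₁ * μ - A₁ * A₁₂ ^ 2 * A₃₄ * A₄₁ ^ 2 * ν = 0 := by
    refine hu.mul_right_eq_zero.mp ?_
    linear_combination θ₂₃ * r_1_4 - θ₃ * A₃ * A₃₄ * r_1_3 - A₁₂ * A₂ * A₂₃ * A₃ * A₃₄ * r_2_3 +
      A₄₁ * r_23_41 + A₁₂ * A₃₄ * A₄₁ * ν * r_2_4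
  exact ⟨r_1_2, r_2_3, r_3_4, r_1_4, r_12_23, r_23_34, r_34_41, r_12_41, r_1_23, r_2_34, r_3_41,
      r_12_4, r_1_34, r_2_41, r_12_3, r_23_4, r_1_3, r_2_4, r_12_34, r_23_41⟩

theorem G2Relations.aeval_genG2_eq_zero {R : Type*} [CommRing R] [Algebra ℂ R] {x : Fin 18 → R}
    (h : G2Relations (x 0) (x 1) (x 2) (x 3) (x 4) (x 5) (x 6) (x 7) (x 8) (x 9) (x 10) (x 11)
      (x 12) (x 13) (x 14) (x 15) (x 16) (x 17)) (m : Fin 5) (s : Fin 4) (d : Bool) :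
    aeval x (genG2 m s d) = 0 := by
  have h1 (s : Fin 4) (d : Bool) : aeval x (f1 s d) = 0 := by
    fin_cases s <;> cases d <;> simp [f1, dih, thpp, aPP, th, thp, aS, aP, -zero_sub] <;>
      first
      | linear_combination h.r_1_2
      | linear_combination h.r_2_3
      | linear_combination h.r_3_4
      | linear_combination h.r_1_4
  have h2 (s : Fin 4) (d : Bool) : aeval x (f2 s d) = 0 := by
    fin_cases s <;> cases d <;> simp [f2, dih, thpp, aPP, th, thp, aS, aP, lam, -zero_sub] <;>
      first
      | linear_combination h.r_12_23
      | linear_combination h.r_23_34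
      | linear_combination h.r_34_41
      | linear_combination h.r_12_41
  have h3 (s : Fin 4) (d : Bool) : aeval x (f3 s d) = 0 := by
    fin_cases s <;> cases d <;> simp [f3, dih, thpp, aPP, th, thp, aS, aP, lam, -zero_sub] <;>
      first
      | linear_combination h.r_1_23
      | linear_combination h.r_2_34
      | linear_combination h.r_3_41
      | linear_combination h.r_12_4
      | linear_combination h.r_1_34
      | linear_combination h.r_2_41
      | linear_combination h.r_12_3
      | linear_combination h.r_23_4
  have h4 (s : Fin 4) (d : Bool) : aeval x (f4 s d) = 0 := by
    fin_cases s <;> cases d <;> simp [f4, dih, aPP, th, aS, aP, lam, -zero_sub] <;>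
      first
      | linear_combination h.r_1_3
      | linear_combination h.r_2_4
  have h5 (s : Fin 4) (d : Bool) : aeval x (f5 s d) = 0 := by
    fin_cases s <;> cases d <;> simp [f5, dih, thpp, aPP, th, thp, aS, aP, lam, -zero_sub] <;>
      first
      | linear_combination h.r_12_34
      | linear_combination h.r_23_41
  fin_cases m
  exacts [h1 s d, h2 s d, h3 s d, h4 s d, h5 s d]

theorem aeval_genG2_eq_zero_of_isUnit_θ₁₂ {R : Type*} [CommRing R] [Algebra ℂ R]
    {x : Fin 18 → R} (hu : IsUnit (x 1)) (h₁ : aeval x (f1 0 true) = 0)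
    (h₂ : aeval x (f2 0 true) = 0) (h₃ : aeval x (f2 3 true) = 0)
    (h₄ : aeval x (f3 2 false) = 0) (h₅ : aeval x (f3 3 true) = 0)
    (h₆ : aeval x (f5 0 true) = 0) (m : Fin 5) (s : Fin 4) (d : Bool) :
    aeval x (genG2 m s d) = 0 := by
  refine G2Relations.aeval_genG2_eq_zero (.of_isUnit_θ₁₂ hu ?_ ?_ ?_ ?_ ?_ ?_) m s d
  · simp [f1, dih, thpp, aPP, th, thp, aS, aP, -zero_sub] at h₁
    linear_combination h₁
  · simp [f2, dih, thpp, aPP, th, thp, aS, aP, lam, -zero_sub] at h₂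
    linear_combination h₂
  · simp [f2, dih, thpp, aPP, th, thp, aS, aP, lam, -zero_sub] at h₃
    linear_combination h₃
  · simp [f3, dih, thpp, aPP, th, thp, aS, aP, lam, -zero_sub] at h₅
    linear_combination h₅
  · simp [f3, dih, thpp, aPP, th, thp, aS, aP, lam, -zero_sub] at h₄
    linear_combination h₄
  · simp [f5, dih, thpp, aPP, th, thp, aS, aP, lam, -zero_sub] at h₆
    linear_combination h₆

theorem aeval_genG2_eq_zero_of_isUnit_θ₁ {R : Type*} [CommRing R] [Algebra ℂ R]
    {x : Fin 18 → R} (hu : IsUnit (x 0)) (h₁ : aeval x (f2 3 true) = 0)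
    (h₂ : aeval x (f1 0 true) = 0) (h₃ : aeval x (f1 3 true) = 0)
    (h₄ : aeval x (f4 0 true) = 0) (h₅ : aeval x (f3 0 true) = 0)
    (h₆ : aeval x (f3 0 false) = 0) (m : Fin 5) (s : Fin 4) (d : Bool) :
    aeval x (genG2 m s d) = 0 := by
  refine G2Relations.aeval_genG2_eq_zero (.of_isUnit_θ₁ hu ?_ ?_ ?_ ?_ ?_ ?_) m s d
  · simp [f1, dih, thpp, aPP, th, thp, aS, aP, -zero_sub] at h₂
    linear_combination h₂
  · simp [f1, dih, thpp, aPP, th, thp, aS, aP, -zero_sub] at h₃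
    linear_combination h₃
  · simp [f2, dih, thpp, aPP, th, thp, aS, aP, lam, -zero_sub] at h₁
    linear_combination h₁
  · simp [f3, dih, thpp, aPP, th, thp, aS, aP, lam, -zero_sub] at h₅
    linear_combination h₅
  · simp [f3, dih, thpp, aPP, th, thp, aS, aP, lam, -zero_sub] at h₆
    linear_combination h₆
  · simp [f4, dih, aPP, th, aS, aP, lam, -zero_sub] at h₄
    linear_combination h₄

open scoped Matrix in
theorem aeval_tangent_genG2_eq_zero_iff {p : Fin 18 → ℂ} (hp : p ∈ XG2) (v : Fin 18 → ℂ)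
    (m : Fin 5) (s : Fin 4) (d : Bool) :
    aeval (fun i => (TrivSqZeroExt.inl (p i) + TrivSqZeroExt.inr (v i) : DualNumber ℂ))
      (genG2 m s d) = 0 ↔ (JacG2 p *ᵥ v) (m, s, d) = 0 := by
  rw [MvPolynomial.aeval_dualNumber, hp m s d, TrivSqZeroExt.inl_zero, zero_add,
    ← TrivSqZeroExt.inr_zero, TrivSqZeroExt.inr_injective.eq_iff]
  rfl

theorem rank_JacG2_of_θ₁₂_ne_zero {p : Fin 18 → ℂ} (hp : p ∈ XG2) (h : p 1 ≠ 0) :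
    (JacG2 p).rank = 6 := by
  refine Matrix.rank_eq_of_pivots _
    (![(0, 0, true), (1, 0, true), (1, 3, true), (2, 2, false), (2, 3, true), (4, 0, true)] :
      Fin 6 → Fin 5 × Fin 4 × Bool) ![9, 3, 7, 4, 6, 5] ?_ ?_ fun v hv => ?_
  · intro i j hij
    fin_cases i <;> fin_cases j <;> first
      | exact absurd hij (by decide)
      | simp [JacG2, genG2, f1, f2, f3, f4, f5, dih, thpp, aPP, th, thp, aS, aP, lam, pderiv_X,
          Derivation.leibniz, Derivation.leibniz_pow, -zero_sub]
  · intro i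
    fin_cases i <;>
      simp [JacG2, genG2, f1, f2, f3, f4, f5, dih, thpp, aPP, th, thp, aS, aP, lam, pderiv_X,
        Derivation.leibniz, Derivation.leibniz_pow, h, -zero_sub]
  · have hrel (i) := (aeval_tangent_genG2_eq_zero_iff hp v _ _ _).mpr (hv i)
    ext ⟨m, s, d⟩
    refine (aeval_tangent_genG2_eq_zero_iff hp v m s d).mp
      (aeval_genG2_eq_zero_of_isUnit_θ₁₂
        (TrivSqZeroExt.isUnit_iff_isUnit_fst.mpr (by simpa using h))
        (hrel 0) (hrel 1) (hrel 2) (hrel 3) (hrel 4) (hrel 5) m s d)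

theorem rank_JacG2_of_θ₁_ne_zero {p : Fin 18 → ℂ} (hp : p ∈ XG2) (h : p 0 ≠ 0) :
    (JacG2 p).rank = 6 := by
  refine Matrix.rank_eq_of_pivots _
    (![(1, 3, true), (0, 0, true), (0, 3, true), (3, 0, true), (2, 0, true), (2, 0, false)] :
      Fin 6 → Fin 5 × Fin 4 × Bool) ![8, 2, 6, 4, 3, 5] ?_ ?_ fun v hv => ?_
  · intro i j hij
    fin_cases i <;> fin_cases j <;> first
      | exact absurd hij (by decide)
      | simp [JacG2, genG2, f1, f2, f3, f4, f5, dih, thpp, aPP, th, thp, aS, aP, lam, pderiv_X,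
          Derivation.leibniz, Derivation.leibniz_pow, -zero_sub]
  · intro i
    fin_cases i <;>
      simp [JacG2, genG2, f1, f2, f3, f4, f5, dih, thpp, aPP, th, thp, aS, aP, lam, pderiv_X,
        Derivation.leibniz, Derivation.leibniz_pow, h, -zero_sub]
  · have hrel (i) := (aeval_tangent_genG2_eq_zero_iff hp v _ _ _).mpr (hv i)
    ext ⟨m, s, d⟩
    refine (aeval_tangent_genG2_eq_zero_iff hp v m s d).mp
      (aeval_genG2_eq_zero_of_isUnit_θ₁
        (TrivSqZeroExt.isUnit_iff_isUnit_fst.mpr (by simpa using h))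
        (hrel 0) (hrel 1) (hrel 2) (hrel 3) (hrel 4) (hrel 5) m s d)

/-- If `p ∈ X_{G₂}` is a point at which at least one of the eight cluster
coordinates is nonzero, then the Jacobian matrix of the twenty generators of `IG2` evaluated
at `p` has rank exactly 6: `X_{G₂}` is smooth at `p`, so the singular locus is contained in
the deep locus `X₀ = X_{G₂} ∩ V(θ₁, θ₁₂, …, θ₄, θ₄₁)`. -/
theorem G2_smooth_where_cluster_nonzero (p : Fin 18 → ℂ) (hp : p ∈ XG2)
    (h : ∃ t : Fin 8, eval p (clusterVar t) ≠ 0) :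
    (JacG2 p).rank = 6 := by
  have rot {i : Fin 18} (H : ∀ q ∈ XG2, q i ≠ 0 → (JacG2 q).rank = 6) :
      ∀ q ∈ XG2, q (rotG2 i) ≠ 0 → (JacG2 q).rank = 6 := fun q hq hi =>
    rank_JacG2_comp_rotG2 q ▸ H _ (mem_XG2_comp_rotG2 hq) hi
  have H₀ (q) (hq : q ∈ XG2) (hi : q 0 ≠ 0) := rank_JacG2_of_θ₁_ne_zero hq hi
  have H₁ (q) (hq : q ∈ XG2) (hi : q 1 ≠ 0) := rank_JacG2_of_θ₁₂_ne_zero hq hi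
  obtain ⟨t, ht⟩ := h
  fin_cases t <;> simp [clusterVar] at ht
  exacts [H₀ p hp ht, H₁ p hp ht, rot H₀ p hp ht, rot H₁ p hp ht, rot (rot H₀) p hp ht,
    rot (rot H₁) p hp ht, rot (rot (rot H₀)) p hp ht, rot (rot (rot H₁)) p hp ht]
end

section
/- Let J ⊆ R₁₈ be the ideal generated by I_{G₂} together with all 6×6 minors of the 20×18 Jacobian matrix of the twenty generators of I_{G₂}. Then the quotient ring R₁₈/J has Krull dimension at most 8; that is, every component of the singular locus of the 12-dimensional variety X_{G₂} has codimension at least 4. -/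
/-!
The G₂ cluster variety.

`R18` is the polynomial ring over ℂ in the 18 variables, indexed as follows:
`0 ↦ θ₁, 1 ↦ θ₁₂, 2 ↦ θ₂, 3 ↦ θ₂₃, 4 ↦ θ₃, 5 ↦ θ₃₄, 6 ↦ θ₄, 7 ↦ θ₄₁,
 8 ↦ A₁, 9 ↦ A₁₂, 10 ↦ A₂, 11 ↦ A₂₃, 12 ↦ A₃, 13 ↦ A₃₄, 14 ↦ A₄, 15 ↦ A₄₁,
 16 ↦ λ₁₃, 17 ↦ λ₂₄`.
Indices `i : Fin 4` stand for the indices 1,2,3,4 taken modulo 4, with `Fin 4` addition.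
-/

open MvPolynomial

noncomputable section

/-- The Jacobian matrix of the generators of `IG2`, with polynomial entries.  Since
permutations in the same dihedral orbit give identical polynomials, its rows are exactly the
rows of the 20×18 Jacobian matrix of the twenty generators (each appearing twice); in
particular its 6×6 minors generate the same ideal as the 6×6 minors of that 20×18 matrix. -/
def JacPolyG2 : Matrix (Fin 5 × Fin 4 × Bool) (Fin 18) R18 :=
  Matrix.of fun a b => pderiv b (genG2 a.1 a.2.1 a.2.2)

/-- The ideal generated by `IG2` together with all 6×6 minors of the Jacobian matrix of the
twenty generators of `IG2`. -/
def singIdealG2 : Ideal R18 :=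
  IG2 ⊔ Ideal.span {x : R18 | ∃ (r : Fin 6 → Fin 5 × Fin 4 × Bool) (c : Fin 6 → Fin 18),
    Function.Injective r ∧ Function.Injective c ∧ x = (JacPolyG2.submatrix r c).det}

end

/-- The Krull dimension of `R ⧸ I` is bounded by the Krull dimensions of the domains `R ⧸ P`
for the primes `P` containing `I`. -/
lemma ringKrullDim_quotient_le_of_forall_isPrime {R : Type*} [CommRing R] (I : Ideal R)
    (n : WithBot ℕ∞)
    (h : ∀ P : Ideal R, P.IsPrime → I ≤ P → ringKrullDim (R ⧸ P) ≤ n) :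
    ringKrullDim (R ⧸ I) ≤ n := by
  rw [ringKrullDim_quotient, Order.krullDim]
  refine iSup_le fun p => ?_
  let q : LTSeries (PrimeSpectrum.zeroLocus (R := R) p.head.1.asIdeal) :=
    LTSeries.mk p.length (fun i => ⟨(p i).1, p.head_le i⟩) fun i j hij => p.strictMono hij
  refine le_trans ?_ (h p.head.1.asIdeal p.head.1.isPrime p.head.2)
  rw [ringKrullDim_quotient]
  exact Order.LTSeries.length_le_krullDim q

/-- A quotient of a polynomial ring over a field in which all variables outside `S` vanish has
Krull dimension at most the cardinality of `S`. -/
lemma MvPolynomial.ringKrullDim_quotient_le_card {σ k : Type*} [Field k]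
    (P : Ideal (MvPolynomial σ k)) (S : Finset σ) (h : ∀ v, v ∉ S → (X v : MvPolynomial σ k) ∈ P) :
    ringKrullDim (MvPolynomial σ k ⧸ P) ≤ S.card := by
  let φ : MvPolynomial S k →ₐ[k] MvPolynomial σ k ⧸ P :=
    (Ideal.Quotient.mkₐ k P).comp (rename Subtype.val)
  have hX : ∀ v, Ideal.Quotient.mkₐ k P (X v) ∈ φ.range := by
    intro v
    by_cases hv : v ∈ S
    · exact ⟨X ⟨v, hv⟩, by simp [φ]⟩
    · rw [Ideal.Quotient.mkₐ_eq_mk, Ideal.Quotient.eq_zero_iff_mem.2 (h v hv)]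
      exact zero_mem _
  have hφ : Function.Surjective φ := by
    intro y
    obtain ⟨f, rfl⟩ := Ideal.Quotient.mkₐ_surjective k P y
    change Ideal.Quotient.mkₐ k P f ∈ φ.range
    induction f using MvPolynomial.induction_on with
    | C a =>
      rw [← algebraMap_eq, AlgHom.commutes]
      exact φ.range.algebraMap_mem a
    | add f g hf hg => rw [map_add]; exact add_mem hf hg
    | mul_X f v hf => rw [map_mul]; exact mul_mem hf (hX v)
  refine (ringKrullDim_le_of_surjective φ.toRingHom hφ).trans ?_
  rw [MvPolynomial.ringKrullDim_of_isNoetherianRing, ringKrullDim_eq_zero_of_field]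
  simp

/-- If a 6×6 submatrix of the Jacobian is lower triangular, then one of its diagonal entries
vanishes along every irreducible closed subset of the singular locus. -/
lemma exists_jacPolyG2_diag_mem {P : Ideal R18} (hprime : P.IsPrime) (hP : singIdealG2 ≤ P)
    (r : Fin 6 → Fin 5 × Fin 4 × Bool) (c : Fin 6 → Fin 18)
    (hr : Function.Injective r) (hc : Function.Injective c)
    (htri : ∀ i j, i < j → JacPolyG2 (r i) (c j) = 0) :
    ∃ i, JacPolyG2 (r i) (c i) ∈ P := by
  have hmem : (JacPolyG2.submatrix r c).det ∈ P :=
    hP (Ideal.mem_sup_right (Ideal.subset_span ⟨r, c, hr, hc, rfl⟩))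
  rw [Matrix.det_of_isLowerTriangular (JacPolyG2.submatrix r c) fun i j hij => htri i j hij] at hmem
  obtain ⟨i, -, hi⟩ := (hprime.prod_mem_iff).1 hmem
  exact ⟨i, hi⟩

lemma f1_true (s : Fin 4) : f1 s true =
    th s * th (s + 1) - aP s * thp s
      - aP (s + 1) * aS (s + 2) * aP (s + 2) ^ 2 * aS (s + 3) * aP (s + 3) := by
  fin_cases s <;> rfl

lemma f2_true (s : Fin 4) : f2 s true =
    thp s * thp (s + 1) - aS (s + 1) * th (s + 1) ^ 3
      - lam (s + 1) * aP (s + 2) * aP (s + 3) * th (s + 1) ^ 2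
      - lam s * aP (s + 2) ^ 2 * aS (s + 3) * aP (s + 3) ^ 2 * th (s + 1)
      - aS (s + 2) * aP (s + 2) ^ 3 * aS (s + 3) ^ 2 * aP (s + 3) ^ 3 * aS s := by
  fin_cases s <;> rfl

lemma f3_true (s : Fin 4) : f3 s true =
    th s * thp (s + 1) - aP s * aS (s + 1) * th (s + 1) ^ 2
      - lam (s + 1) * aP (s + 2) * aP (s + 3) * aP s * th (s + 1)
      - lam s * aP (s + 2) ^ 2 * aS (s + 3) * aP (s + 3) ^ 2 * aP s
      - aS (s + 2) * aP (s + 2) ^ 2 * aS (s + 3) * aP (s + 3) * th (s + 2) := by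
  fin_cases s <;> rfl

lemma f3_false (s : Fin 4) : f3 s false =
    th s * thp (s + 2) - aP (s + 3) * aS (s + 3) * th (s + 3) ^ 2
      - lam (s + 1) * aP (s + 1) * aP s * aP (s + 3) * th (s + 3)
      - lam s * aP (s + 1) ^ 2 * aS (s + 1) * aP s ^ 2 * aP (s + 3)
      - aS (s + 2) * aP (s + 1) ^ 2 * aS (s + 1) * aP s * th (s + 2) := by
  fin_cases s <;> rfl

lemma f4_true (s : Fin 4) : f4 s true =
    th s * th (s + 2) - aP s * aS (s + 1) * aP (s + 1) * th (s + 1)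
      - lam (s + 1) * aP s * aP (s + 1) * aP (s + 2) * aP (s + 3)
      - aP (s + 2) * aS (s + 3) * aP (s + 3) * th (s + 3) := by
  fin_cases s <;> rfl

lemma f5_true (s : Fin 4) : f5 s true =
    thp s * thp (s + 2) - aS (s + 1) * aP (s + 1) ^ 2 * aS (s + 2) * th (s + 1) * th (s + 2)
      - aP (s + 3) * aP (s + 1)
        * (lam s * th s * th (s + 2) + lam (s + 1) * th (s + 1) * th (s + 3))
      - aS (s + 3) * aP (s + 3) ^ 2 * aS s * th (s + 3) * th s
      - aP s * aP (s + 1) ^ 2 * aP (s + 2) * aP (s + 3) ^ 2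
        * (aS s * aS (s + 1) * aS (s + 2) * aS (s + 3) - lam s * lam (s + 1)) := by
  fin_cases s <;> rfl

lemma jacPolyG2_apply (m : Fin 5) (s : Fin 4) (d : Bool) (v : Fin 18) :
    JacPolyG2 (m, s, d) v = pderiv v (genG2 m s d) := rfl

set_option maxHeartbeats 2000000 in
/-- Each `θₛ` vanishes on the singular locus: where it is invertible, `Aₛ` and the five cluster
variables other than `θₛ` and its two neighbours can be eliminated. -/
lemma th_mem {P : Ideal R18} (hprime : P.IsPrime) (hP : singIdealG2 ≤ P) (s : Fin 4) :
    th s ∈ P := by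
  obtain ⟨i, hi⟩ := exists_jacPolyG2_diag_mem hprime hP
    ![(1, s + 3, true), (0, s, true), (0, s + 3, true), (3, s, true), (2, s, true), (2, s, false)]
    ![(![8, 10, 12, 14] : Fin 4 → Fin 18) s, (![0, 2, 4, 6] : Fin 4 → Fin 18) (s + 1),
      (![0, 2, 4, 6] : Fin 4 → Fin 18) (s + 3), (![0, 2, 4, 6] : Fin 4 → Fin 18) (s + 2),
      (![1, 3, 5, 7] : Fin 4 → Fin 18) (s + 1), (![1, 3, 5, 7] : Fin 4 → Fin 18) (s + 2)]
    (by revert s; decide) (by revert s; decide) (by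
      fin_cases s <;> intro i j hij <;> fin_cases i <;> fin_cases j <;>
      first
      | exact absurd hij (by decide)
      | simp [jacPolyG2_apply, genG2, f1_true, f2_true, f3_true, f4_true, th, thp, aP, aS, lam,
          pderiv_X])
  fin_cases s <;> fin_cases i <;>
  · simp [jacPolyG2_apply, genG2, f1_true, f2_true, f3_true, f3_false, f4_true, th, thp, aP,
      aS, lam, pderiv_X] at hi ⊢
    first
    | exact hi
    | exact hprime.mem_of_pow_mem _ hi

set_option maxHeartbeats 2000000 in
/-- Each `θ_{s,s+1}` vanishes on the singular locus: where it is invertible, `A_{s,s+1}` and the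
five cluster variables other than `θ_{s,s+1}` and its two neighbours can be eliminated. -/
lemma thp_mem {P : Ideal R18} (hprime : P.IsPrime) (hP : singIdealG2 ≤ P) (s : Fin 4) :
    thp s ∈ P := by
  obtain ⟨i, hi⟩ := exists_jacPolyG2_diag_mem hprime hP
    ![(0, s, true), (1, s, true), (1, s + 3, true), (2, s + 2, false), (2, s + 3, true),
      (4, s, true)]
    ![(![9, 11, 13, 15] : Fin 4 → Fin 18) s, (![1, 3, 5, 7] : Fin 4 → Fin 18) (s + 1),
      (![1, 3, 5, 7] : Fin 4 → Fin 18) (s + 3), (![0, 2, 4, 6] : Fin 4 → Fin 18) (s + 2),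
      (![0, 2, 4, 6] : Fin 4 → Fin 18) (s + 3), (![1, 3, 5, 7] : Fin 4 → Fin 18) (s + 2)]
    (by revert s; decide) (by revert s; decide) (by
      fin_cases s <;> intro i j hij <;> fin_cases i <;> fin_cases j <;>
      first
      | exact absurd hij (by decide)
      | simp [jacPolyG2_apply, genG2, f1_true, f2_true, f3_true, f3_false, f5_true, th, thp, aP,
          aS, lam, pderiv_X])
  fin_cases s <;> fin_cases i <;>
  · simp [jacPolyG2_apply, genG2, f1_true, f2_true, f3_true, f3_false, f5_true, th, thp, aP,
      aS, lam, pderiv_X] at hi ⊢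
    exact hi

set_option maxHeartbeats 2000000 in
/-- Some `A_{s,s+1}` vanishes along each irreducible closed subset of the singular locus: where all
of them are invertible, the four `θ_{s,s+1}` and both parameters can be eliminated. -/
lemma exists_aP_mem {P : Ideal R18} (hprime : P.IsPrime) (hP : singIdealG2 ≤ P) :
    ∃ s, aP s ∈ P := by
  obtain ⟨i, hi⟩ := exists_jacPolyG2_diag_mem hprime hP
    ![(0, 0, true), (0, 1, true), (0, 2, true), (0, 3, true), (3, 0, true), (3, 1, true)]
    ![1, 3, 5, 7, 17, 16] (by decide) (by decide) (by
      intro i j hij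
      fin_cases i <;> fin_cases j <;>
      first
      | exact absurd hij (by decide)
      | simp [jacPolyG2_apply, genG2, f1_true, f4_true, th, thp, aP, aS, lam, pderiv_X])
  rw [Fin.exists_fin_succ, Fin.exists_fin_succ, Fin.exists_fin_succ, Fin.exists_fin_one]
  fin_cases i <;>
  · simp [jacPolyG2_apply, genG2, f1_true, f4_true, th, thp, aP, aS, lam, pderiv_X,
      hprime.mul_mem_iff_mem_or_mem] at hi ⊢
    tauto

/-- Along each irreducible closed subset of the singular locus, at least two of the ten
variables other than the cluster variables vanish. -/
lemma exists_two_X_mem {P : Ideal R18} (hprime : P.IsPrime) (hP : singIdealG2 ≤ P) :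
    ∃ u v : Fin 18, 8 ≤ u ∧ 8 ≤ v ∧ u ≠ v ∧ (X u : R18) ∈ P ∧ (X v : R18) ∈ P := by
  obtain ⟨s, hs⟩ := exists_aP_mem hprime hP
  have hf : f1 s true ∈ P :=
    hP (Ideal.mem_sup_left (Ideal.subset_span ⟨(0, s, true), rfl⟩))
  rw [f1_true, sub_mem_comm_iff, P.sub_mem_iff_left (sub_mem
    (P.mul_mem_right _ (th_mem hprime hP s)) (P.mul_mem_right _ hs))] at hf
  simp only [hprime.mul_mem_iff_mem_or_mem, hprime.pow_mem_iff_mem _ two_pos] at hf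
  fin_cases s <;> rcases hf with (((h | h) | h) | h) | h <;>
  exact ⟨_, _, by decide, by decide, by decide, hs, h⟩

/-- The quotient `R18 ⧸ singIdealG2` has Krull dimension at most 8; that
is, every component of the singular locus of the 12-dimensional variety `X_{G₂}` has
codimension at least 4. -/
theorem G2_singular_locus_dim : ringKrullDim (R18 ⧸ singIdealG2) ≤ 8 := by
  refine ringKrullDim_quotient_le_of_forall_isPrime _ _ fun P hprime hP => ?_
  obtain ⟨u, v, hu, hv, huv, hXu, hXv⟩ := exists_two_X_mem hprime hP
  have hcluster : ∀ w : Fin 18, w < 8 → (X w : R18) ∈ P := by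
    have hth := th_mem hprime hP
    have hthp := thp_mem hprime hP
    intro w hw
    fin_cases w <;>
    first
    | exact absurd hw (by decide)
    | exact hth 0
    | exact hthp 0
    | exact hth 1
    | exact hthp 1
    | exact hth 2
    | exact hthp 2
    | exact hth 3
    | exact hthp 3
  let S : Finset (Fin 18) := ((Finset.Ici 8).erase u).erase v
  have hS : S.card = 8 := by
    rw [Finset.card_erase_of_mem (by simp [hv, huv.symm]), Finset.card_erase_of_mem (by simp [hu])]
    rfl
  refine (MvPolynomial.ringKrullDim_quotient_le_card P S fun w hw => ?_).trans (by rw [hS]; rfl)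
  by_cases hwv : w = v
  · exact hwv ▸ hXv
  by_cases hwu : w = u
  · exact hwu ▸ hXu
  exact hcluster w (by simpa [S, hwv, hwu] using hw)
end
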